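/- Fix β ∈ (−1,1). As Δ = 2−α → 0⁺, the mixed Fisher information of characteristic exponent and skewness satisfies log(1/Δ)·I_{αβ}(α) → 0, i.e. I_{αβ}(α) = o(1/log(1/Δ)), where I_{αβ}(α) = ∫_ℝ f_α(x;α,β)·f_β(x;α,β) / f(x;α,β) dx. -/

import Mathlib

open MeasureTheory Filter Set Topology Real

/-- Shift parameter ζ = −β·tan(πα/2) in Zolotarev's (M) parameterization. -/
noncomputable def zetaPar (α β : ℝ) : ℝ := -β * Real.tan (Real.pi * α / 2)

/-- Standard stable density in Zolotarev's (M) parameterization, via the inversion formula. -/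
noncomputable def stableDensity (α β x : ℝ) : ℝ :=
  (1 / Real.pi) *
    (∫ t in Set.Ioi (0 : ℝ),
      Complex.exp (-(Complex.I * (t : ℂ) * (x : ℂ))) *
        Complex.exp (-(((t ^ α : ℝ) : ℂ)) *
          (1 + Complex.I * (β : ℂ) * ((Real.tan (Real.pi * α / 2) : ℝ) : ℂ) *
            (((t ^ (1 - α) : ℝ) : ℂ) - 1)))).re

/-- The N(0,2) density f(y;2). -/
noncomputable def normalDensity (y : ℝ) : ℝ :=
  (1 / (2 * Real.sqrt Real.pi)) * Real.exp (-(y ^ 2) / 4)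

/-- Partial derivative of the stable density with respect to α. -/
noncomputable def fAlpha (α β x : ℝ) : ℝ := deriv (fun a : ℝ => stableDensity a β x) α

/-- Partial derivative of the stable density with respect to β. -/
noncomputable def fBeta (α β x : ℝ) : ℝ := deriv (fun b : ℝ => stableDensity α b x) β

/-- Derivative of the stable density in x. -/
noncomputable def fX (α β x : ℝ) : ℝ := deriv (stableDensity α β) x

/-- The scale score numerator f_σ = −f − x·f′. -/
noncomputable def fSig (α β x : ℝ) : ℝ := -stableDensity α β x - x * fX α β x

/-! ## Contour shifting -/

lemma integrable_exp_neg_abs_aux : Integrable (fun u : ℝ => Real.exp (-|u|)) := by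
  rw [← integrableOn_univ, ← Set.Iic_union_Ioi (a := (0:ℝ))]
  refine IntegrableOn.union ?_ ?_
  · refine (integrableOn_exp_Iic 0).congr_fun (fun u hu => ?_) measurableSet_Iic
    rw [abs_of_nonpos hu, neg_neg]
  · refine (integrableOn_exp_neg_Ioi 0).congr_fun (fun u hu => ?_) measurableSet_Ioi
    rw [abs_of_pos hu]

lemma strip_shift (G : ℂ → ℂ) (hG : Differentiable ℂ G) (a b K : ℝ) (hab : a ≤ b)
    (hb : ∀ u v : ℝ, a ≤ v → v ≤ b → ‖G (u + v * Complex.I)‖ ≤ K * Real.exp (-|u|)) :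
    ∫ u : ℝ, G (u + a * Complex.I) = ∫ u : ℝ, G (u + b * Complex.I) := by
  have hgint : ∀ v, a ≤ v → v ≤ b → Integrable (fun u : ℝ => G (u + v * Complex.I)) := by
    intro v h1 h2
    refine Integrable.mono' (integrable_exp_neg_abs_aux.const_mul K) ?_ ?_
    · exact (hG.continuous.comp (by fun_prop)).aestronglyMeasurable
    · exact Eventually.of_forall fun u => hb u v h1 h2
  have hlim : ∀ v, a ≤ v → v ≤ b → Tendsto (fun T : ℝ => ∫ u in (-T)..T, G (u + v * Complex.I))
      atTop (𝓝 (∫ u : ℝ, G (u + v * Complex.I))) := fun v h1 h2 =>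
    intervalIntegral_tendsto_integral (hgint v h1 h2) tendsto_neg_atTop_atBot tendsto_id
  have hver : ∀ σ : ℝ, |σ| = 1 → Tendsto (fun T : ℝ => ∫ v in a..b, G ((σ * T : ℝ) + v * Complex.I))
      atTop (𝓝 0) := by
    intro σ hσ
    have h0 : Tendsto (fun T : ℝ => K * Real.exp (-T) * |b - a|) atTop (𝓝 0) := by
      have := (Real.tendsto_exp_neg_atTop_nhds_zero.const_mul K).mul_const |b - a|
      simpa using this
    refine squeeze_zero_norm' ?_ h0
    filter_upwards [eventually_ge_atTop 0] with T hT
    refine intervalIntegral.norm_integral_le_of_norm_le_const fun v hv => ?_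
    rw [uIoc_of_le hab] at hv
    have := hb (σ * T) v hv.1.le hv.2
    rwa [abs_mul, hσ, one_mul, abs_of_nonneg hT] at this
  have hrect : ∀ T : ℝ, ((∫ u in (-T)..T, G (u + a * Complex.I)) -
      ∫ u in (-T)..T, G (u + b * Complex.I)) +
      Complex.I • (∫ v in a..b, G (((1:ℝ) * T : ℝ) + v * Complex.I)) -
      Complex.I • (∫ v in a..b, G (((-1:ℝ) * T : ℝ) + v * Complex.I)) = 0 := by
    intro T
    have := Complex.integral_boundary_rect_eq_zero_of_differentiableOn G
      ((-T : ℝ) + a * Complex.I) ((T : ℝ) + b * Complex.I) hG.differentiableOn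
    simpa using this
  have hl := (((hlim a le_rfl hab).sub (hlim b hab le_rfl)).add
    ((hver 1 (by simp)).const_smul Complex.I)).sub ((hver (-1) (by simp)).const_smul Complex.I)
  simp only [hrect] at hl
  have := tendsto_nhds_unique hl tendsto_const_nhds
  simpa [sub_eq_zero] using this

lemma integral_Ioi_exp_subst (g : ℝ → ℂ) :
    ∫ s in Ioi (0:ℝ), g s = ∫ u : ℝ, (Real.exp u : ℂ) * g (Real.exp u) := by
  have := integral_image_eq_integral_abs_deriv_smul (s := univ) (f := Real.exp) (f' := Real.exp)
    MeasurableSet.univ (fun x _ => (Real.hasDerivAt_exp x).hasDerivWithinAt)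
    Real.exp_injective.injOn g
  rw [image_univ, Real.range_exp] at this
  rw [this, Measure.restrict_univ]
  refine integral_congr_ae (Eventually.of_forall fun u => ?_)
  simp [abs_of_pos (Real.exp_pos u)]

/-! ## Basic functions -/

noncomputable def tauP (a : ℝ) : ℝ := -Real.tan (Real.pi * a / 2)

noncomputable def PP (a s : ℝ) : ℂ :=
  Complex.exp ((a : ℂ) * ((Real.log s : ℂ) - (Real.pi / 6 : ℝ) * Complex.I))

noncomputable def kk (x s : ℝ) : ℂ :=
  Complex.exp (-((Real.pi / 6 : ℝ) * Complex.I)) * Complex.exp (-(Complex.I * x * PP 1 s))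

noncomputable def qq (a b s : ℝ) : ℂ :=
  Complex.I * b * tauP a * PP 1 s - (1 + Complex.I * b * tauP a) * PP a s

lemma PP_re (a s : ℝ) (hs : 0 < s) : (PP a s).re = s ^ a * Real.cos (a * (Real.pi / 6)) := by
  rw [PP, Complex.exp_re, Real.rpow_def_of_pos hs]
  simp [mul_comm]

lemma PP_im (a s : ℝ) (hs : 0 < s) : (PP a s).im = -(s ^ a * Real.sin (a * (Real.pi / 6))) := by
  rw [PP, Complex.exp_im, Real.rpow_def_of_pos hs]
  simp [mul_comm]

lemma norm_PP (a s : ℝ) (hs : 0 < s) : ‖PP a s‖ = s ^ a := by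
  rw [PP, Complex.norm_exp, Real.rpow_def_of_pos hs]
  simp [mul_comm]

lemma norm_kk (x s : ℝ) (hs : 0 < s) : ‖kk x s‖ = Real.exp (-(x * s / 2)) := by
  have h1 := PP_im 1 s hs
  rw [kk, norm_mul, Complex.norm_exp, Complex.norm_exp]
  simp [h1]; ring_nf

structure Good (a : ℝ) : Prop where
  lo : 19 / 10 ≤ a
  hi : a ≤ 21 / 10
  tau : |tauP a| ≤ 1 / 8
  cos : 3 / 8 ≤ Real.cos (a * (Real.pi / 6))
  cosne : Real.cos (Real.pi * a / 2) ≠ 0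

lemma mul_exp_neg_le (c r : ℝ) (hc : 0 < c) (hr : 0 < r) (n : ℕ) :
    r ^ n * Real.exp (-(c * r)) ≤ n.factorial / c ^ n := by
  have h1 := Real.pow_div_factorial_le_exp (c * r) (by positivity) n
  rw [Real.exp_neg, ← div_eq_mul_inv, div_le_div_iff₀ (Real.exp_pos _) (by positivity)]
  rw [div_le_iff₀ (by positivity)] at h1
  rw [mul_pow] at h1
  linarith

lemma decay_aux (r a : ℝ) (hr : 0 < r) (ha : 1 ≤ a) : r / 8 - r ^ a / 4 ≤ 1 - r / 8 := by
  rcases le_total 1 r with h | h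
  · have := Real.rpow_le_rpow_of_exponent_le h ha
    rw [Real.rpow_one] at this
    linarith
  · have := Real.rpow_nonneg hr.le a
    linarith

lemma exp_neg_abs_bound (u c C : ℝ) (_hC0 : 0 ≤ C) (hr2 : c ≤ C * Real.exp (-u))
    (hr1 : c ≤ C * Real.exp u) : c ≤ C * Real.exp (-|u|) := by
  rcases abs_cases u with ⟨h, _⟩ | ⟨h, _⟩
  · rw [h]; exact hr2
  · rw [h, neg_neg]; exact hr1

lemma PP_exp (a u : ℝ) : PP a (Real.exp u) =
    Complex.exp (a * (u + (-(Real.pi / 6) : ℝ) * Complex.I)) := by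
  rw [PP, Real.log_exp]; congr 1; push_cast; ring

lemma gam_lemma (a x : ℝ) (ha : 0 ≤ a) (ha3 : a ≤ 3) (hx : 0 < x) :
    ∫ s in Ioi (0:ℝ), kk x s * PP a s =
      Complex.exp (-(Complex.I * (Real.pi * (a + 1) / 2 : ℝ))) *
        ((Real.Gamma (a + 1) * x ^ (-(a + 1)) : ℝ) : ℂ) := by
  set G : ℂ → ℂ := fun w => Complex.exp (-(Complex.I * x * Complex.exp w)) *
    Complex.exp ((a + 1) * w) with hGdef
  have hGd : Differentiable ℂ G := by
    intro w; simp only [hGdef]; fun_prop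
  obtain ⟨K, hK0, hK⟩ : ∃ K : ℝ, 0 ≤ K ∧ ∀ u : ℝ,
      Real.exp (-(x / 2 * Real.exp u)) * Real.exp ((a + 1) * u) ≤ K * Real.exp (-|u|) := by
    refine ⟨1 + (Nat.factorial 5) / (x / 2) ^ 5, by positivity, fun u => ?_⟩
    refine exp_neg_abs_bound _ _ _ (by positivity) ?_ ?_
    · have h5 := mul_exp_neg_le (x / 2) (Real.exp u) (by positivity) (Real.exp_pos u) 5
      have : Real.exp (-(x / 2 * Real.exp u)) * Real.exp ((a + 1) * u) =
        (Real.exp (-(x / 2 * Real.exp u)) * Real.exp ((a + 2) * u)) * Real.exp (-u) := by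
        simp only [← Real.exp_add]; congr 1; ring
      rw [this]
      refine mul_le_mul_of_nonneg_right ?_ (Real.exp_pos _).le
      rcases le_total 0 u with h | h
      · have h2 : Real.exp ((a + 2) * u) ≤ Real.exp u ^ 5 := by
          rw [← Real.exp_nat_mul]
          apply Real.exp_le_exp.2
          push_cast
          nlinarith
        calc _ ≤ Real.exp (-(x / 2 * Real.exp u)) * Real.exp u ^ 5 := by gcongr
          _ ≤ _ := by rw [mul_comm]; linarith
      · have h1 : Real.exp (-(x / 2 * Real.exp u)) ≤ 1 :=
          Real.exp_le_one_iff.2 (by have := Real.exp_pos u; nlinarith)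
        have h2 : Real.exp ((a + 2) * u) ≤ 1 := Real.exp_le_one_iff.2 (by nlinarith)
        have h3 : 0 ≤ (Nat.factorial 5 : ℝ) / (x / 2) ^ 5 := by positivity
        calc _ ≤ (1:ℝ) * 1 := by gcongr
          _ ≤ _ := by linarith
    · have h1 : Real.exp (-(x / 2 * Real.exp u)) ≤ 1 :=
          Real.exp_le_one_iff.2 (by have := Real.exp_pos u; nlinarith)
      rcases le_total 0 u with h | h
      · have h5 := mul_exp_neg_le (x / 2) (Real.exp u) (by positivity) (Real.exp_pos u) 5
        have h2 : Real.exp ((a + 1) * u) ≤ Real.exp u ^ 5 := by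
          rw [← Real.exp_nat_mul]
          apply Real.exp_le_exp.2
          push_cast
          nlinarith
        have h4 : 1 ≤ Real.exp u := Real.one_le_exp h
        have h3 : 0 ≤ (Nat.factorial 5 : ℝ) / (x / 2) ^ 5 := by positivity
        calc _ ≤ Real.exp (-(x / 2 * Real.exp u)) * Real.exp u ^ 5 := by gcongr
          _ ≤ (1 + (Nat.factorial 5) / (x / 2) ^ 5) * 1 := by rw [mul_comm]; linarith
          _ ≤ _ := by gcongr
      · have h2 : Real.exp ((a + 1) * u) ≤ Real.exp u := Real.exp_le_exp.2 (by nlinarith)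
        have h3 : 0 ≤ (Nat.factorial 5 : ℝ) / (x / 2) ^ 5 := by positivity
        calc _ ≤ 1 * Real.exp u := by gcongr
          _ ≤ _ := by gcongr; linarith
  have hb : ∀ u v : ℝ, -(Real.pi / 2) ≤ v → v ≤ -(Real.pi / 6) →
      ‖G (u + v * Complex.I)‖ ≤ K * Real.exp (-|u|) := by
    intro u v h1 h2
    refine le_trans ?_ (hK u)
    simp only [hGdef]
    rw [norm_mul, Complex.norm_exp, Complex.norm_exp]
    have hsin : Real.sin v ≤ -(1 / 2) := by
      rw [← Real.sin_pi_div_six, ← Real.sin_neg]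
      exact Real.sin_le_sin_of_le_of_le_pi_div_two h1 (by linarith [Real.pi_pos]) h2
    have e1 : (-(Complex.I * x * Complex.exp (u + v * Complex.I))).re =
        x * Real.exp u * Real.sin v := by
      simp [Complex.exp_im]; ring
    have e2 : (((a:ℂ) + 1) * (u + v * Complex.I)).re = (a + 1) * u := by simp
    rw [e1, e2]
    gcongr
    have := mul_pos hx (Real.exp_pos u)
    nlinarith
  have hs := strip_shift G hGd (-(Real.pi / 2)) (-(Real.pi / 6)) K
    (by linarith [Real.pi_pos]) hb
  have hR : ∫ s in Ioi (0:ℝ), kk x s * PP a s =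
      ∫ u : ℝ, G (u + (-(Real.pi / 6) : ℝ) * Complex.I) := by
    rw [integral_Ioi_exp_subst]
    refine integral_congr_ae (Eventually.of_forall fun u => ?_)
    simp only [hGdef, kk, PP_exp]
    simp only [Complex.ofReal_exp, ← Complex.exp_add]
    congr 1
    push_cast
    ring_nf
  have hL : ∫ u : ℝ, G (u + (-(Real.pi / 2) : ℝ) * Complex.I) =
      ∫ s in Ioi (0:ℝ), Complex.exp (-(Complex.I * (Real.pi * (a + 1) / 2 : ℝ))) *
        ((s ^ (a + 1 - 1) * Real.exp (-(x * s)) : ℝ) : ℂ) := by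
    rw [integral_Ioi_exp_subst]
    refine integral_congr_ae (Eventually.of_forall fun u => ?_)
    simp only [hGdef]
    have e1 : Complex.exp (u + (-(Real.pi / 2) : ℝ) * Complex.I) = -Complex.I * Real.exp u := by
      rw [Complex.exp_add]
      have : (((-(Real.pi / 2) : ℝ)) : ℂ) * Complex.I = -(Real.pi / 2 * Complex.I) := by
        push_cast; ring
      rw [this, Complex.exp_neg, Complex.exp_pi_div_two_mul_I]
      simp; ring
    rw [e1, ← Real.exp_mul]
    have e2 : -(Complex.I * x * (-Complex.I * Real.exp u)) = ((-(x * Real.exp u) : ℝ) : ℂ) := by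
      push_cast
      linear_combination (x * Complex.exp u : ℂ) * Complex.I_mul_I
    rw [e2]
    push_cast
    simp only [← Complex.exp_add]
    congr 1
    ring
  rw [hR, ← hs, hL, integral_const_mul, integral_complex_ofReal,
    Real.integral_rpow_mul_exp_neg_mul_Ioi (by linarith) hx]
  rw [one_div, Real.inv_rpow hx.le, ← Real.rpow_neg hx.le, mul_comm (Real.Gamma _)]

lemma stable_exponent (a b x t : ℝ) (ht : 0 < t) :
    Complex.exp (-(Complex.I * (t : ℂ) * (x : ℂ))) *
        Complex.exp (-(((t ^ a : ℝ) : ℂ)) *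
          (1 + Complex.I * (b : ℂ) * ((Real.tan (Real.pi * a / 2) : ℝ) : ℂ) *
            (((t ^ (1 - a) : ℝ) : ℂ) - 1))) =
    Complex.exp (-(Complex.I * x * t) + Complex.I * b * tauP a * t
      - (1 + Complex.I * b * tauP a) * ((t ^ a : ℝ) : ℂ)) := by
  rw [← Complex.exp_add]
  congr 1
  have h : ((t ^ a : ℝ) : ℂ) * ((t ^ (1 - a) : ℝ) : ℂ) = t := by
    rw [← Complex.ofReal_mul, ← Real.rpow_add ht]; simp
  rw [tauP]
  push_cast at h ⊢
  linear_combination (-(Complex.I * b * Complex.tan (Real.pi * a / 2))) * h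

lemma rot_lemma (a b x : ℝ) (ha : Good a) (hb1 : |b| ≤ 1) (hx : 0 ≤ x) :
    stableDensity a b x = (1 / Real.pi) *
      (∫ s in Ioi (0:ℝ), kk x s * Complex.exp (qq a b s)).re := by
  set τ := tauP a with hτ
  have hbt : |b * τ| ≤ 1 / 8 := by
    rw [abs_mul]
    calc _ ≤ 1 * (1 / 8 : ℝ) := by gcongr; exact ha.tau
      _ = _ := by ring
  rw [stableDensity]
  congr 2
  set G : ℂ → ℂ := fun w => Complex.exp w * Complex.exp (-(Complex.I * x * Complex.exp w)
    + Complex.I * b * τ * Complex.exp w - (1 + Complex.I * b * τ) * Complex.exp (a * w)) with hGdef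
  have hGd : Differentiable ℂ G := by
    intro w; simp only [hGdef]; fun_prop
  have hb : ∀ u v : ℝ, -(Real.pi / 6) ≤ v → v ≤ 0 →
      ‖G (u + v * Complex.I)‖ ≤ (128 * Real.exp 1) * Real.exp (-|u|) := by
    intro u v h1 h2
    have hpi := Real.pi_pos
    have halo := ha.lo
    have hahi := ha.hi
    set r := Real.exp u with hr
    have hr0 : 0 < r := Real.exp_pos u
    have hre : (-(Complex.I * x * Complex.exp (u + v * Complex.I))
      + Complex.I * b * τ * Complex.exp (u + v * Complex.I)
        - (1 + Complex.I * b * τ) * Complex.exp (a * (u + v * Complex.I))).re ≤ 1 - r / 8 := by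
      have e : (-(Complex.I * x * Complex.exp (u + v * Complex.I))
        + Complex.I * b * τ * Complex.exp (u + v * Complex.I)
        - (1 + Complex.I * b * τ) * Complex.exp (a * (u + v * Complex.I))).re =
        x * r * Real.sin v - (b * τ) * r * Real.sin v
          - r ^ a * (Real.cos (a * v) - (b * τ) * Real.sin (a * v)) := by
        simp [Complex.exp_im, Complex.exp_re, hr, ← Real.exp_mul]
        ring_nf
      rw [e]
      have hsin0 : Real.sin v ≤ 0 := Real.sin_nonpos_of_nonpos_of_neg_pi_le h2 (by linarith)
      have hsin1 := Real.abs_sin_le_one v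
      have hsin2 := Real.abs_sin_le_one (a * v)
      have hcos : 3 / 8 ≤ Real.cos (a * v) := by
        refine ha.cos.trans ?_
        rw [← Real.cos_neg (a * v)]
        refine Real.cos_le_cos_of_nonneg_of_le_pi ?_ ?_ ?_ <;> nlinarith
      have p1 : -((b * τ) * Real.sin v) ≤ 1 / 8 := by
        have := abs_mul (b * τ) (Real.sin v)
        have h3 : |b * τ| * |Real.sin v| ≤ 1 / 8 * 1 := by gcongr
        linarith [neg_abs_le (b * τ * Real.sin v)]
      have p2 : (b * τ) * Real.sin (a * v) ≤ 1 / 8 := by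
        have := abs_mul (b * τ) (Real.sin (a * v))
        have h3 : |b * τ| * |Real.sin (a * v)| ≤ 1 / 8 * 1 := by gcongr
        linarith [le_abs_self (b * τ * Real.sin (a * v))]
      have p3 : x * r * Real.sin v ≤ 0 := mul_nonpos_of_nonneg_of_nonpos (by positivity) hsin0
      have p4 := decay_aux r a hr0 (by linarith)
      have p5 : 0 ≤ r ^ a := Real.rpow_nonneg hr0.le a
      nlinarith
    have hn : ‖G (u + v * Complex.I)‖ ≤ r * Real.exp (1 - r / 8) := by
      simp only [hGdef]
      rw [norm_mul, Complex.norm_exp, Complex.norm_exp]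
      have : ((u:ℂ) + v * Complex.I).re = u := by simp
      rw [this]
      gcongr
    refine hn.trans (exp_neg_abs_bound _ _ _ (by positivity) ?_ ?_)
    · rw [Real.exp_neg, ← hr, ← div_eq_mul_inv, le_div_iff₀ hr0]
      have := mul_exp_neg_le (1 / 8) r (by norm_num) hr0 2
      have e : Real.exp (1 - r / 8) = Real.exp 1 * Real.exp (-(1 / 8 * r)) := by
        rw [← Real.exp_add]; ring_nf
      rw [e]
      norm_num [Nat.factorial] at this ⊢
      nlinarith [Real.exp_pos 1]
    · rw [← hr]
      have : Real.exp (1 - r / 8) ≤ Real.exp 1 := Real.exp_le_exp.2 (by linarith)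
      nlinarith [Real.exp_pos 1]
  have hs := strip_shift G hGd (-(Real.pi / 6)) 0 _ (by linarith [Real.pi_pos]) hb
  have hR : ∫ s in Ioi (0:ℝ), kk x s * Complex.exp (qq a b s) =
      ∫ u : ℝ, G (u + (-(Real.pi / 6) : ℝ) * Complex.I) := by
    rw [integral_Ioi_exp_subst]
    refine integral_congr_ae (Eventually.of_forall fun u => ?_)
    simp only [hGdef, kk, qq, PP_exp, ← hτ]
    simp only [Complex.ofReal_exp, ← Complex.exp_add]
    congr 1
    push_cast
    ring_nf
  rw [hR, hs, integral_Ioi_exp_subst]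
  refine integral_congr_ae (Eventually.of_forall fun u => ?_)
  simp only
  rw [stable_exponent _ _ _ _ (Real.exp_pos u), ← hτ, ← Real.exp_mul]
  simp only [hGdef]
  push_cast
  simp only [← Complex.exp_add]
  congr 1
  ring_nf

/-! ## Bounds on the exponent and its derivatives -/

noncomputable def ww (s : ℝ) : ℝ := s ^ (3 / 2 : ℝ) + s ^ (4 : ℝ)

noncomputable def tauD (a : ℝ) : ℝ := -((1 + Real.tan (Real.pi * a / 2) ^ 2) * (Real.pi / 2))

noncomputable def ell (s : ℝ) : ℂ := (Real.log s : ℂ) - (Real.pi / 6 : ℝ) * Complex.I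

noncomputable def qa (a b s : ℝ) : ℂ :=
  Complex.I * b * tauD a * (PP 1 s - PP a s) - (1 + Complex.I * b * tauP a) * (ell s * PP a s)

noncomputable def qb (a s : ℝ) : ℂ := Complex.I * tauP a * (PP 1 s - PP a s)

lemma ww_nonneg (s : ℝ) (hs : 0 < s) : 0 ≤ ww s := by unfold ww; positivity

lemma rpow_le_ww (a s : ℝ) (ha : Good a) (hs : 0 < s) : s ^ a ≤ ww s := by
  have h1 := ha.lo
  have h2 := ha.hi
  unfold ww
  rcases le_total 1 s with h | h
  · have := Real.rpow_le_rpow_of_exponent_le h (by linarith : a ≤ 4)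
    have := Real.rpow_nonneg hs.le (3 / 2)
    linarith
  · have := Real.rpow_le_rpow_of_exponent_ge hs h (by linarith : 3 / 2 ≤ a)
    have := Real.rpow_nonneg hs.le 4
    linarith

lemma rpow_log_le_ww (a s : ℝ) (ha : Good a) (hs : 0 < s) : s ^ a * |Real.log s| ≤ 3 * ww s := by
  have h1 := ha.lo
  have h2 := ha.hi
  unfold ww
  have hp := Real.rpow_nonneg hs.le (3 / 2)
  have hq := Real.rpow_nonneg hs.le 4
  rcases le_total 1 s with h | h
  · rw [abs_of_nonneg (Real.log_nonneg h)]
    have h3 := Real.rpow_le_rpow_of_exponent_le h (by linarith : a ≤ 3)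
    have h4 : Real.log s ≤ s := by linarith [Real.log_le_sub_one_of_pos hs]
    have h5 : s ^ (4:ℝ) = s ^ (3:ℝ) * s := by
      rw [show (4:ℝ) = 3 + 1 by norm_num, Real.rpow_add hs, Real.rpow_one]
    have : s ^ a * Real.log s ≤ s ^ (3:ℝ) * s :=
      mul_le_mul h3 h4 (Real.log_nonneg h) (by positivity)
    rw [← h5] at this
    linarith
  · have h3 := Real.abs_log_mul_self_rpow_lt s (a - 3 / 2) hs h (by linarith)
    have h4 : 1 / (a - 3 / 2) ≤ 3 := by
      rw [div_le_iff₀ (by linarith)]; linarith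
    have h5 : s ^ a = s ^ (3 / 2 : ℝ) * s ^ (a - 3 / 2) := by
      rw [← Real.rpow_add hs]; ring_nf
    rw [abs_mul, abs_of_nonneg (Real.rpow_nonneg hs.le (a - 3 / 2))] at h3
    rw [h5]
    nlinarith

lemma norm_one_add (a b : ℝ) (ha : Good a) (hb : |b| ≤ 1) :
    ‖(1 : ℂ) + Complex.I * b * tauP a‖ ≤ 9 / 8 := by
  refine (norm_add_le _ _).trans ?_
  simp only [norm_one, norm_mul, Complex.norm_I, Complex.norm_real, Real.norm_eq_abs, one_mul]
  have : |b| * |tauP a| ≤ 1 * (1 / 8) := mul_le_mul hb ha.tau (abs_nonneg _) (by norm_num)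
  linarith

lemma norm_qq_le (a b s : ℝ) (ha : Good a) (hb : |b| ≤ 1) (hs : 0 < s) :
    ‖qq a b s‖ ≤ |tauP a| * s + 2 * ww s := by
  unfold qq
  refine (norm_sub_le _ _).trans ?_
  have h1 : ‖Complex.I * b * tauP a * PP 1 s‖ ≤ |tauP a| * s := by
    simp only [norm_mul, Complex.norm_I, Complex.norm_real, Real.norm_eq_abs, one_mul,
      norm_PP _ _ hs, Real.rpow_one]
    have : |b| * |tauP a| ≤ 1 * |tauP a| := by gcongr
    nlinarith
  have h2 : ‖(1 + Complex.I * b * tauP a) * PP a s‖ ≤ 2 * ww s := by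
    rw [norm_mul, norm_PP _ _ hs]
    have := norm_one_add a b ha hb
    have h3 := rpow_le_ww a s ha hs
    have h4 := ww_nonneg s hs
    have h5 := Real.rpow_nonneg hs.le a
    nlinarith
  linarith

lemma qq_re_le (a b s : ℝ) (ha : Good a) (hb : |b| ≤ 1) (hs : 0 < s) :
    (qq a b s).re ≤ 1 - s / 8 := by
  have h1 := PP_re 1 s hs
  have h2 := PP_im 1 s hs
  have h3 := PP_re a s hs
  have h4 := PP_im a s hs
  have e : (qq a b s).re = (b * tauP a) * (s * Real.sin (1 * (Real.pi / 6)))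
      - s ^ a * (Real.cos (a * (Real.pi / 6)) + (b * tauP a) * Real.sin (a * (Real.pi / 6))) := by
    simp [qq, h1, h2, h3, h4]; ring
  rw [e]
  have hbt : |b * tauP a| ≤ 1 / 8 := by
    rw [abs_mul]
    calc _ ≤ 1 * (1 / 8 : ℝ) := by gcongr; exact ha.tau
      _ = _ := by ring
  rw [one_mul, Real.sin_pi_div_six]
  have hsin := Real.abs_sin_le_one (a * (Real.pi / 6))
  have p2 : -(1 / 8) ≤ (b * tauP a) * Real.sin (a * (Real.pi / 6)) := by
    have := abs_mul (b * tauP a) (Real.sin (a * (Real.pi / 6)))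
    have h3 : |b * tauP a| * |Real.sin (a * (Real.pi / 6))| ≤ 1 / 8 * 1 := by gcongr
    linarith [neg_abs_le (b * tauP a * Real.sin (a * (Real.pi / 6)))]
  have p4 := decay_aux s a hs (by linarith [ha.lo])
  have p5 : 0 ≤ s ^ a := Real.rpow_nonneg hs.le a
  have p6 := ha.cos
  have p7 := abs_le.1 hbt
  nlinarith

lemma norm_exp_qq (a b s : ℝ) (ha : Good a) (hb : |b| ≤ 1) (hs : 0 < s) :
    ‖Complex.exp (qq a b s)‖ ≤ Real.exp 1 * Real.exp (-(1 / 8 * s)) := by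
  rw [Complex.norm_exp, ← Real.exp_add]
  exact Real.exp_le_exp.2 (by linarith [qq_re_le a b s ha hb hs])

lemma norm_exp_qq_sub_one (a b s : ℝ) (ha : Good a) (hb : |b| ≤ 1) (hs : 0 < s) :
    ‖Complex.exp (qq a b s) - 1‖ ≤ 4 * ‖qq a b s‖ := by
  rcases le_total ‖qq a b s‖ 1 with h | h
  · have := Complex.norm_exp_sub_one_le h
    linarith [norm_nonneg (qq a b s)]
  · have h1 := norm_exp_qq a b s ha hb hs
    have h2 : Real.exp (-(1 / 8 * s)) ≤ 1 := Real.exp_le_one_iff.2 (by linarith)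
    have h3 := Real.exp_one_lt_d9
    have h4 := norm_sub_le (Complex.exp (qq a b s)) 1
    rw [norm_one] at h4
    nlinarith [Real.exp_pos 1]

lemma tauD_abs (a : ℝ) (ha : Good a) : |tauD a| ≤ 2 := by
  have h := ha.tau
  unfold tauP at h
  rw [abs_neg] at h
  have h2 := abs_le.1 h
  have h3 := Real.pi_lt_d2
  have h4 := Real.pi_pos
  unfold tauD
  rw [abs_neg, abs_of_nonneg (by positivity)]
  nlinarith

lemma norm_ell (s : ℝ) : ‖ell s‖ ≤ |Real.log s| + 1 := by
  unfold ell
  refine (norm_sub_le _ _).trans ?_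
  simp only [norm_mul, Complex.norm_I, Complex.norm_real, Real.norm_eq_abs, mul_one]
  have : |Real.pi / 6| ≤ 1 := by
    rw [abs_of_pos (by positivity)]; linarith [Real.pi_lt_d2]
  linarith

lemma norm_PP_sub (a s : ℝ) (ha : Good a) (hs : 0 < s) : ‖PP 1 s - PP a s‖ ≤ s + ww s := by
  refine (norm_sub_le _ _).trans ?_
  rw [norm_PP _ _ hs, norm_PP _ _ hs, Real.rpow_one]
  linarith [rpow_le_ww a s ha hs]

lemma norm_qa (a b s : ℝ) (ha : Good a) (hb : |b| ≤ 1) (hs : 0 < s) :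
    ‖qa a b s‖ ≤ 7 * (s + ww s) := by
  unfold qa
  refine (norm_sub_le _ _).trans ?_
  have hw := ww_nonneg s hs
  have h1 : ‖Complex.I * b * tauD a * (PP 1 s - PP a s)‖ ≤ 2 * (s + ww s) := by
    simp only [norm_mul, Complex.norm_I, Complex.norm_real, Real.norm_eq_abs, one_mul]
    have : |b| * |tauD a| ≤ 1 * 2 := mul_le_mul hb (tauD_abs a ha) (abs_nonneg _) (by norm_num)
    have h2 := norm_PP_sub a s ha hs
    calc _ ≤ (1 * 2) * (s + ww s) := mul_le_mul this h2 (norm_nonneg _) (by norm_num)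
      _ = _ := by ring
  have h2 : ‖(1 + Complex.I * b * tauP a) * (ell s * PP a s)‖ ≤ 9 / 8 * (4 * ww s) := by
    rw [norm_mul]
    refine mul_le_mul (norm_one_add a b ha hb) ?_ (norm_nonneg _) (by norm_num)
    rw [norm_mul, norm_PP _ _ hs]
    have h3 := rpow_le_ww a s ha hs
    have h4 := rpow_log_le_ww a s ha hs
    have h5 := Real.rpow_nonneg hs.le a
    nlinarith [norm_ell s]
  linarith

lemma norm_qb (a s : ℝ) (ha : Good a) (hs : 0 < s) :
    ‖qb a s‖ ≤ |tauP a| * (s + ww s) := by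
  unfold qb
  simp only [norm_mul, Complex.norm_I, Complex.norm_real, Real.norm_eq_abs, one_mul]
  exact mul_le_mul_of_nonneg_left (norm_PP_sub a s ha hs) (abs_nonneg _)

lemma prod_bound (s t : ℝ) (hs : 0 < s) (_ht0 : 0 ≤ t) (ht : t ≤ 1) :
    (s + ww s) * (t * s + 2 * ww s) ≤
      t * s ^ (2:ℝ) + 20 * (s ^ (5 / 2 : ℝ) + s ^ (8:ℝ)) := by
  set r := Real.sqrt s with hr
  have hr0 : 0 < r := Real.sqrt_pos.2 hs
  have hsr : s = r ^ 2 := (Real.sq_sqrt hs.le).symm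
  have key : ∀ n : ℕ, s ^ ((n:ℝ) / 2) = r ^ n := by
    intro n
    rw [hr, Real.sqrt_eq_rpow, ← Real.rpow_natCast, ← Real.rpow_mul hs.le]
    congr 1; ring
  have e3 : s ^ (3 / 2 : ℝ) = r ^ 3 := by have := key 3; push_cast at this; exact this
  have e4 : s ^ (4 : ℝ) = r ^ 8 := by
    have := key 8; push_cast at this; rw [← this]; norm_num
  have e2 : s ^ (2 : ℝ) = r ^ 4 := by
    have := key 4; push_cast at this; rw [← this]; norm_num
  have e5 : s ^ (5 / 2 : ℝ) = r ^ 5 := by have := key 5; push_cast at this; exact this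
  have e8 : s ^ (8 : ℝ) = r ^ 16 := by
    have := key 16; push_cast at this; rw [← this]; norm_num
  have mid : ∀ n : ℕ, 5 ≤ n → n ≤ 16 → r ^ n ≤ r ^ 5 + r ^ 16 := by
    intro n h1 h2
    rcases le_total 1 r with h | h
    · have := pow_le_pow_right₀ h h2
      have : 0 ≤ r ^ 5 := by positivity
      linarith
    · have := pow_le_pow_of_le_one hr0.le h h1
      have : 0 ≤ r ^ 16 := by positivity
      linarith
  unfold ww
  rw [e3, e4, e2, e5, e8]
  rw [hsr]
  have m5 := mid 5 (by norm_num) (by norm_num)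
  have m6 := mid 6 (by norm_num) (by norm_num)
  have m10 := mid 10 (by norm_num) (by norm_num)
  have m11 := mid 11 (by norm_num) (by norm_num)
  have m16 := mid 16 (by norm_num) (by norm_num)
  have n5 : t * r ^ 5 ≤ 1 * r ^ 5 := by gcongr
  have n10 : t * r ^ 10 ≤ 1 * r ^ 10 := by gcongr
  have e : (r ^ 2 + (r ^ 3 + r ^ 8)) * (t * r ^ 2 + 2 * (r ^ 3 + r ^ 8)) =
    t * r ^ 4 + t * r ^ 5 + t * r ^ 10 + 2 * r ^ 5 + 2 * r ^ 10 + 2 * r ^ 6 + 4 * r ^ 11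
      + 2 * r ^ 16 := by ring
  rw [e]
  linarith

/-! ## Integrability -/

lemma intg (p c : ℝ) (hp : -1 < p) (hc : 0 < c) :
    IntegrableOn (fun s : ℝ => s ^ p * Real.exp (-(c * s))) (Ioi 0) := by
  have := integrableOn_rpow_mul_exp_neg_mul_rpow (p := 1) hp one_pos hc
  refine this.congr_fun (fun s _ => ?_) measurableSet_Ioi
  simp

lemma intg_ww (c : ℝ) (hc : 0 < c) :
    IntegrableOn (fun s : ℝ => (s + ww s) * Real.exp (-(c * s))) (Ioi 0) := by
  have := ((intg 1 c (by norm_num) hc).add (intg (3 / 2) c (by norm_num) hc)).add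
    (intg 4 c (by norm_num) hc)
  refine this.congr_fun (fun s _ => ?_) measurableSet_Ioi
  simp [ww]; ring

lemma meas_PP (a : ℝ) : Measurable (fun s => PP a s) := by
  unfold PP; fun_prop

lemma meas_kk (x : ℝ) : Measurable (fun s => kk x s) := by
  have := meas_PP 1
  unfold kk; fun_prop

lemma meas_qq (a b : ℝ) : Measurable (fun s => qq a b s) := by
  have := meas_PP 1
  have := meas_PP a
  unfold qq; fun_prop

lemma meas_qa (a b : ℝ) : Measurable (fun s => qa a b s) := by
  have := meas_PP 1
  have := meas_PP a
  unfold qa ell; fun_prop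

lemma meas_qb (a : ℝ) : Measurable (fun s => qb a s) := by
  have := meas_PP 1
  have := meas_PP a
  unfold qb; fun_prop

lemma norm_kk_le_one (x s : ℝ) (hx : 0 ≤ x) (hs : 0 < s) : ‖kk x s‖ ≤ 1 := by
  rw [norm_kk x s hs]
  exact Real.exp_le_one_iff.2 (by have := mul_nonneg hx hs.le; linarith)

/-! ## Derivatives -/

lemma hasDerivAt_PP (a s : ℝ) : HasDerivAt (fun a' => PP a' s) (ell s * PP a s) a := by
  unfold PP ell
  have h := ((Complex.ofRealCLM.hasDerivAt (x := a)).mul_const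
    ((Real.log s : ℂ) - (Real.pi / 6 : ℝ) * Complex.I)).cexp
  simp only [Complex.ofRealCLM_apply] at h
  convert h using 1
  simp [mul_comm]

lemma hasDerivAt_tauP (a : ℝ) (ha : Good a) : HasDerivAt tauP (tauD a) a := by
  unfold tauP
  have h1 : HasDerivAt (fun a : ℝ => Real.pi * a / 2) (Real.pi / 2) a := by
    simpa using ((hasDerivAt_id a).const_mul Real.pi).div_const 2
  have h := ((Real.hasDerivAt_tan ha.cosne).comp a h1).neg
  refine h.congr_deriv ?_
  unfold tauD
  rw [← Real.inv_one_add_tan_sq ha.cosne]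
  simp

lemma hasDerivAt_qq_a (a b s : ℝ) (ha : Good a) :
    HasDerivAt (fun a' => qq a' b s) (qa a b s) a := by
  unfold qq
  have h1 := (hasDerivAt_tauP a ha).ofReal_comp
  have h2 := (h1.const_mul (Complex.I * b))
  have h3 := (h2.mul_const (PP 1 s)).sub ((h2.const_add 1).mul (hasDerivAt_PP a s))
  refine h3.congr_deriv ?_
  unfold qa; ring

lemma hasDerivAt_qq_b (a b s : ℝ) :
    HasDerivAt (fun b' => qq a b' s) (qb a s) b := by
  unfold qq
  have h1 := ((hasDerivAt_id b).ofReal_comp)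
  have h2 := ((h1.const_mul Complex.I).mul_const (tauP a : ℂ))
  have h3 := (h2.mul_const (PP 1 s)).sub ((h2.const_add 1).mul_const (PP a s))
  refine h3.congr_deriv ?_
  unfold qb; simp; ring

/-! ## Differentiation under the integral sign -/

lemma ae_Ioi {p : ℝ → Prop} (h : ∀ s, 0 < s → p s) :
    ∀ᵐ s ∂(volume.restrict (Ioi (0:ℝ))), p s :=
  (ae_restrict_mem measurableSet_Ioi).mono fun s hs => h s hs

lemma integrable_kk_exp (a b x : ℝ) (ha : Good a) (hb : |b| ≤ 1) (hx : 0 ≤ x) :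
    IntegrableOn (fun s => kk x s * Complex.exp (qq a b s)) (Ioi 0) := by
  have hm1 := meas_kk x
  have hm2 := meas_qq a b
  refine Integrable.mono' ((intg 0 (1 / 8) (by norm_num) (by norm_num)).const_mul (Real.exp 1))
    (Measurable.aestronglyMeasurable (by fun_prop)) (ae_Ioi fun s hs => ?_)
  rw [norm_mul, Real.rpow_zero, one_mul]
  have h1 := norm_kk_le_one x s hx hs
  have h2 := norm_exp_qq a b s ha hb hs
  calc _ ≤ 1 * _ := mul_le_mul h1 h2 (norm_nonneg _) (by norm_num)
    _ = _ := one_mul _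

lemma bound_exp_mul (a b x s A : ℝ) (z : ℂ) (ha : Good a) (hb : |b| ≤ 1) (hx : 0 ≤ x) (hs : 0 < s)
    (hz : ‖z‖ ≤ A * (s + ww s)) :
    ‖kk x s * (Complex.exp (qq a b s) * z)‖ ≤
      Real.exp 1 * A * ((s + ww s) * Real.exp (-(1 / 8 * s))) := by
  rw [norm_mul, norm_mul]
  have h1 := norm_kk_le_one x s hx hs
  have h2 := norm_exp_qq a b s ha hb hs
  calc _ ≤ 1 * ((Real.exp 1 * Real.exp (-(1 / 8 * s))) * (A * (s + ww s))) :=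
        mul_le_mul h1 (mul_le_mul h2 hz (norm_nonneg _) (by positivity)) (by positivity)
          (by norm_num)
    _ = _ := by ring

lemma hasDeriv_stable_a (a b x : ℝ) (ha : ∀ᶠ a' in 𝓝 a, Good a') (hb : |b| ≤ 1) (hx : 0 ≤ x) :
    IntegrableOn (fun s => kk x s * (Complex.exp (qq a b s) * qa a b s)) (Ioi 0) ∧
    HasDerivAt (fun a' => stableDensity a' b x)
      ((1 / Real.pi) * (∫ s in Ioi (0:ℝ), kk x s * (Complex.exp (qq a b s) * qa a b s)).re) a := by
  have hm1 := meas_kk x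
  have hm2 := fun a => meas_qq a b
  have hm3 := meas_qa a b
  have h := hasDerivAt_integral_of_dominated_loc_of_deriv_le
    (μ := volume.restrict (Ioi (0:ℝ)))
    (F := fun a' s => kk x s * Complex.exp (qq a' b s))
    (F' := fun a' s => kk x s * (Complex.exp (qq a' b s) * qa a' b s))
    (bound := fun s => Real.exp 1 * 7 * ((s + ww s) * Real.exp (-(1 / 8 * s))))
    ha (Eventually.of_forall fun a' => Measurable.aestronglyMeasurable
      (by have := hm2 a'; fun_prop))
    (integrable_kk_exp a b x ha.self_of_nhds hb hx)
    (Measurable.aestronglyMeasurable (by have := hm2 a; fun_prop))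
    (ae_Ioi fun s hs a' ha' => bound_exp_mul a' b x s 7 _ ha' hb hx hs (norm_qa a' b s ha' hb hs))
    ((intg_ww (1 / 8) (by norm_num)).const_mul _)
    (ae_Ioi fun s hs a' ha' => ((hasDerivAt_qq_a a' b s ha').cexp).const_mul _)
  refine ⟨h.1, ?_⟩
  have h2 := (Complex.reCLM.hasFDerivAt.comp_hasDerivAt a h.2).const_mul (1 / Real.pi)
  refine HasDerivAt.congr_of_eventuallyEq h2 ?_
  filter_upwards [ha] with a' ha'
  exact rot_lemma a' b x ha' hb hx

lemma hasDeriv_stable_b (a b x : ℝ) (ha : Good a) (hb : |b| < 1) (hx : 0 ≤ x) :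
    IntegrableOn (fun s => kk x s * (Complex.exp (qq a b s) * qb a s)) (Ioi 0) ∧
    HasDerivAt (fun b' => stableDensity a b' x)
      ((1 / Real.pi) * (∫ s in Ioi (0:ℝ), kk x s * (Complex.exp (qq a b s) * qb a s)).re) b := by
  have hm1 := meas_kk x
  have hm2 := fun b => meas_qq a b
  have hm3 := meas_qb a
  have hN : ∀ᶠ b' in 𝓝 b, |b'| < 1 := continuous_abs.continuousAt.eventually (gt_mem_nhds hb)
  have h := hasDerivAt_integral_of_dominated_loc_of_deriv_le
    (μ := volume.restrict (Ioi (0:ℝ)))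
    (F := fun b' s => kk x s * Complex.exp (qq a b' s))
    (F' := fun b' s => kk x s * (Complex.exp (qq a b' s) * qb a s))
    (bound := fun s => Real.exp 1 * |tauP a| * ((s + ww s) * Real.exp (-(1 / 8 * s))))
    hN (Eventually.of_forall fun b' => Measurable.aestronglyMeasurable
      (by have := hm2 b'; fun_prop))
    (integrable_kk_exp a b x ha hb.le hx)
    (Measurable.aestronglyMeasurable (by have := hm2 b; fun_prop))
    (ae_Ioi fun s hs b' hb' => bound_exp_mul a b' x s |tauP a| _ ha (le_of_lt hb') hx hs
      (norm_qb a s ha hs))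
    ((intg_ww (1 / 8) (by norm_num)).const_mul _)
    (ae_Ioi fun s hs b' hb' => ((hasDerivAt_qq_b a b' s).cexp).const_mul _)
  refine ⟨h.1, ?_⟩
  have h2 := (Complex.reCLM.hasFDerivAt.comp_hasDerivAt b h.2).const_mul (1 / Real.pi)
  refine HasDerivAt.congr_of_eventuallyEq h2 ?_
  filter_upwards [hN] with b' hb'
  exact rot_lemma a b' x ha (le_of_lt hb') hx

noncomputable def CW : ℝ := ∫ s in Ioi (0:ℝ), (s + ww s) * Real.exp (-(1 / 8 * s))

lemma CW_nonneg : 0 ≤ CW :=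
  setIntegral_nonneg measurableSet_Ioi fun s hs =>
    mul_nonneg (add_nonneg (le_of_lt hs) (ww_nonneg s hs)) (Real.exp_pos _).le

lemma pi_inv_le_one (z : ℂ) (M : ℝ) (h : ‖z‖ ≤ M) : |(1 / Real.pi) * z.re| ≤ M := by
  have h1 : |1 / Real.pi| ≤ 1 := by
    rw [abs_of_pos (by positivity), div_le_one Real.pi_pos]; linarith [Real.pi_gt_three]
  rw [abs_mul]
  have := Complex.abs_re_le_norm z
  calc _ ≤ 1 * M := mul_le_mul h1 (this.trans h) (abs_nonneg _) (by norm_num)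
    _ = M := one_mul M

lemma fAlpha_bdd (a b x : ℝ) (ha : ∀ᶠ a' in 𝓝 a, Good a') (hb : |b| ≤ 1) (hx : 0 ≤ x) :
    |fAlpha a b x| ≤ Real.exp 1 * 7 * CW := by
  rw [fAlpha, (hasDeriv_stable_a a b x ha hb hx).2.deriv]
  apply pi_inv_le_one
  rw [CW, ← integral_const_mul]
  exact norm_integral_le_of_norm_le ((intg_ww (1 / 8) (by norm_num)).const_mul _)
    (ae_Ioi fun s hs => bound_exp_mul a b x s 7 _ ha.self_of_nhds hb hx hs
      (norm_qa a b s ha.self_of_nhds hb hs))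

lemma fBeta_bdd (a b x : ℝ) (ha : Good a) (hb : |b| < 1) (hx : 0 ≤ x) :
    |fBeta a b x| ≤ Real.exp 1 * CW * |tauP a| := by
  rw [fBeta, (hasDeriv_stable_b a b x ha hb hx).2.deriv]
  apply pi_inv_le_one
  rw [show Real.exp 1 * CW * |tauP a| = Real.exp 1 * |tauP a| * CW by ring, CW,
    ← integral_const_mul]
  exact norm_integral_le_of_norm_le ((intg_ww (1 / 8) (by norm_num)).const_mul _)
    (ae_Ioi fun s hs => bound_exp_mul a b x s |tauP a| _ ha hb.le hx hs
      (norm_qb a s ha hs))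

/-! ## The leading term -/

noncomputable def SS (a : ℝ) : ℝ := Real.sin (Real.pi * a / 2) * Real.Gamma (a + 1)

lemma integrable_kk_PP (a x : ℝ) (ha : 0 ≤ a) (hx : 0 < x) :
    IntegrableOn (fun s => kk x s * PP a s) (Ioi 0) := by
  have hm1 := meas_kk x
  have hm2 := meas_PP a
  refine Integrable.mono' (intg a (x / 2) (by linarith) (by linarith))
    (Measurable.aestronglyMeasurable (by fun_prop)) (ae_Ioi fun s hs => ?_)
  rw [norm_mul, norm_kk x s hs, norm_PP a s hs, mul_comm]
  ring_nf; rfl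

lemma exp_I_re (θ : ℝ) : (Complex.exp (-(Complex.I * (θ : ℝ)))).re = Real.cos θ := by
  rw [Complex.exp_re]; simp

lemma exp_I_im (θ : ℝ) : (Complex.exp (-(Complex.I * (θ : ℝ)))).im = -Real.sin θ := by
  rw [Complex.exp_im]; simp

lemma int_kk_qq (a b x : ℝ) (ha : Good a) (hx : 0 < x) :
    (∫ s in Ioi (0:ℝ), kk x s * qq a b s).re = (1 + b) * SS a * x ^ (-(a + 1)) := by
  have h1 := integrable_kk_PP 1 x (by norm_num) hx
  have h2 := integrable_kk_PP a x (by linarith [ha.lo]) hx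
  have e : ∫ s in Ioi (0:ℝ), kk x s * qq a b s =
      (Complex.I * b * tauP a) * (∫ s in Ioi (0:ℝ), kk x s * PP 1 s) -
      (1 + Complex.I * b * tauP a) * (∫ s in Ioi (0:ℝ), kk x s * PP a s) := by
    rw [← integral_const_mul, ← integral_const_mul, ← integral_sub (h1.const_mul _)
      (h2.const_mul _)]
    refine integral_congr_ae (Eventually.of_forall fun s => ?_)
    simp only [qq]; ring
  rw [e, gam_lemma 1 x (by norm_num) (by norm_num) hx,
    gam_lemma a x (by linarith [ha.lo]) (by linarith [ha.hi]) hx]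
  set g1 := Real.Gamma (1 + 1) * x ^ (-((1:ℝ) + 1))
  set g2 := Real.Gamma (a + 1) * x ^ (-(a + 1)) with hg2
  have c1 : Real.sin (Real.pi * (1 + 1) / 2) = 0 := by
    rw [show Real.pi * (1 + 1) / 2 = Real.pi by ring, Real.sin_pi]
  have c2 : Real.cos (Real.pi * (a + 1) / 2) = -Real.sin (Real.pi * a / 2) := by
    rw [show Real.pi * (a + 1) / 2 = Real.pi * a / 2 + Real.pi / 2 by ring,
      Real.cos_add_pi_div_two]
  have c3 : Real.sin (Real.pi * (a + 1) / 2) = Real.cos (Real.pi * a / 2) := by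
    rw [show Real.pi * (a + 1) / 2 = Real.pi * a / 2 + Real.pi / 2 by ring,
      Real.sin_add_pi_div_two]
  have c4 : tauP a * Real.cos (Real.pi * a / 2) = -Real.sin (Real.pi * a / 2) := by
    rw [tauP, neg_mul, Real.tan_mul_cos ha.cosne]
  have d1 := exp_I_re (Real.pi * (1 + 1) / 2)
  have d2 := exp_I_im (Real.pi * (1 + 1) / 2)
  have d3 := exp_I_re (Real.pi * (a + 1) / 2)
  have d4 := exp_I_im (Real.pi * (a + 1) / 2)
  rw [c1] at d2
  rw [c2] at d3
  rw [c3] at d4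
  set E1 := Complex.exp (-(Complex.I * (Real.pi * (1 + 1) / 2 : ℝ)))
  set E2 := Complex.exp (-(Complex.I * (Real.pi * (a + 1) / 2 : ℝ)))
  have : ((Complex.I * b * tauP a) * (E1 * (g1:ℂ)) -
      (1 + Complex.I * b * tauP a) * (E2 * (g2:ℂ))).re =
      -(b * tauP a * (E1.im * g1)) - (E2.re * g2 - b * tauP a * (E2.im * g2)) := by
    simp
  rw [this, d2, d3, d4, SS]
  linear_combination (-b * g2) * c4 + (1 + b) * Real.sin (Real.pi * a / 2) * hg2

lemma norm_kk_mul (x s M : ℝ) (z : ℂ) (hs : 0 < s) (hz : ‖z‖ ≤ M) :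
    ‖kk x s * z‖ ≤ M * Real.exp (-(x / 2 * s)) := by
  rw [norm_mul, norm_kk x s hs, mul_comm, show x * s / 2 = x / 2 * s by ring]
  gcongr

lemma int_kk_qa (a b x : ℝ) (ha : ∀ᶠ a' in 𝓝 a, Good a') (hb : |b| ≤ 1) (hx : 0 < x) :
    IntegrableOn (fun s => kk x s * qa a b s) (Ioi 0) ∧
    HasDerivAt (fun a' => (1 + b) * SS a' * x ^ (-(a' + 1)))
      (∫ s in Ioi (0:ℝ), kk x s * qa a b s).re a := by
  have hm1 := meas_kk x
  have hm2 := fun a => meas_qq a b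
  have hm3 := meas_qa a b
  have hi : IntegrableOn (fun s => kk x s * qq a b s) (Ioi 0) := by
    refine Integrable.mono' ((intg_ww (x / 2) (by linarith)).const_mul 2)
      (Measurable.aestronglyMeasurable (by have := hm2 a; fun_prop)) (ae_Ioi fun s hs => ?_)
    rw [← mul_assoc]
    refine norm_kk_mul x s _ _ hs ?_
    refine (norm_qq_le a b s ha.self_of_nhds hb hs).trans ?_
    have := ha.self_of_nhds.tau
    nlinarith
  have h := hasDerivAt_integral_of_dominated_loc_of_deriv_le
    (μ := volume.restrict (Ioi (0:ℝ)))
    (F := fun a' s => kk x s * qq a' b s)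
    (F' := fun a' s => kk x s * qa a' b s)
    (bound := fun s => 7 * ((s + ww s) * Real.exp (-(x / 2 * s))))
    ha (Eventually.of_forall fun a' => Measurable.aestronglyMeasurable
      (by have := hm2 a'; fun_prop))
    hi
    (Measurable.aestronglyMeasurable (by fun_prop))
    (ae_Ioi fun s hs a' ha' => by
      rw [← mul_assoc]
      exact norm_kk_mul x s _ _ hs (norm_qa a' b s ha' hb hs))
    ((intg_ww (x / 2) (by linarith)).const_mul _)
    (ae_Ioi fun s hs a' ha' => (hasDerivAt_qq_a a' b s ha').const_mul _)
  refine ⟨h.1, ?_⟩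
  have h2 := (Complex.reCLM.hasFDerivAt.comp_hasDerivAt a h.2)
  refine HasDerivAt.congr_of_eventuallyEq h2 ?_
  filter_upwards [ha] with a' ha'
  exact (int_kk_qq a' b x ha' hx).symm

lemma int_kk_qb (a x : ℝ) (ha : Good a) (hx : 0 < x) :
    IntegrableOn (fun s => kk x s * qb a s) (Ioi 0) ∧
    (∫ s in Ioi (0:ℝ), kk x s * qb a s).re = SS a * x ^ (-(a + 1)) := by
  have h1 := integrable_kk_PP 1 x (by norm_num) hx
  have h2 := integrable_kk_PP a x (by linarith [ha.lo]) hx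
  have i : ∀ b, IntegrableOn (fun s => kk x s * qq a b s) (Ioi 0) := by
    intro b
    refine ((h1.const_mul (Complex.I * b * tauP a)).sub
      (h2.const_mul (1 + Complex.I * b * tauP a))).congr (Eventually.of_forall fun s => ?_)
    simp only [qq, Pi.sub_apply]; ring
  have e : ∀ s, kk x s * qb a s = kk x s * qq a 1 s - kk x s * qq a 0 s := by
    intro s; simp only [qb, qq]; push_cast; ring
  simp only [e]
  refine ⟨(i 1).sub (i 0), ?_⟩
  rw [integral_sub (i 1) (i 0), Complex.sub_re, int_kk_qq a 1 x ha hx, int_kk_qq a 0 x ha hx]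
  ring

/-! ## Asymptotics in `x`, uniform in the exponent -/

lemma intg_val (p x : ℝ) (hp : -1 < p) (hx : 0 < x) :
    ∫ s in Ioi (0:ℝ), s ^ p * Real.exp (-(x / 2 * s)) =
      (2 ^ (p + 1) * Real.Gamma (p + 1)) * x ^ (-(p + 1)) := by
  have := Real.integral_rpow_mul_exp_neg_mul_Ioi (a := p + 1) (r := x / 2) (by linarith)
    (by linarith)
  rw [add_sub_cancel_right] at this
  rw [this, one_div, inv_div, Real.div_rpow (by norm_num) hx.le, Real.rpow_neg hx.le]
  field_simp

noncomputable def ee (t s : ℝ) : ℝ := t * s ^ (2:ℝ) + 20 * (s ^ (5 / 2 : ℝ) + s ^ (8:ℝ))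

lemma intg_ee (t x : ℝ) (hx : 0 < x) :
    IntegrableOn (fun s : ℝ => ee t s * Real.exp (-(x / 2 * s))) (Ioi 0) := by
  have i2 : IntegrableOn (fun s : ℝ => t * (s ^ (2:ℝ) * Real.exp (-(x / 2 * s)))) (Ioi 0) :=
    (intg 2 (x / 2) (by norm_num) (by linarith)).const_mul t
  have i5 : IntegrableOn (fun s : ℝ => 20 * (s ^ (5 / 2 : ℝ) * Real.exp (-(x / 2 * s)) +
      s ^ (8:ℝ) * Real.exp (-(x / 2 * s)))) (Ioi 0) :=
    ((intg (5 / 2) (x / 2) (by norm_num) (by linarith)).add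
    (intg 8 (x / 2) (by norm_num) (by linarith))).const_mul 20
  have i : IntegrableOn (fun s : ℝ => t * (s ^ (2:ℝ) * Real.exp (-(x / 2 * s))) +
      20 * (s ^ (5 / 2 : ℝ) * Real.exp (-(x / 2 * s)) +
      s ^ (8:ℝ) * Real.exp (-(x / 2 * s)))) (Ioi 0) := i2.add i5
  refine IntegrableOn.congr_fun i (fun s _ => ?_) measurableSet_Ioi
  simp only [ee]; ring

lemma err_int : ∃ C : ℝ, 0 < C ∧ ∀ x t : ℝ, 1 ≤ x → 0 ≤ t →
    x ^ 3 * ∫ s in Ioi (0:ℝ), ee t s * Real.exp (-(x / 2 * s)) ≤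
      C * (t + x ^ (-(1 / 2) : ℝ)) := by
  set A := (2:ℝ) ^ ((2:ℝ) + 1) * Real.Gamma (2 + 1)
  set B := (2:ℝ) ^ ((5 / 2 : ℝ) + 1) * Real.Gamma (5 / 2 + 1)
  set D := (2:ℝ) ^ ((8 : ℝ) + 1) * Real.Gamma (8 + 1)
  have hA : 0 < A := mul_pos (by positivity) (Real.Gamma_pos_of_pos (by norm_num))
  have hB : 0 < B := mul_pos (by positivity) (Real.Gamma_pos_of_pos (by norm_num))
  have hD : 0 < D := mul_pos (by positivity) (Real.Gamma_pos_of_pos (by norm_num))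
  refine ⟨A + 20 * B + 20 * D, by positivity, fun x t hx ht => ?_⟩
  have hx0 : 0 < x := by linarith
  have e : ∫ s in Ioi (0:ℝ), ee t s * Real.exp (-(x / 2 * s)) =
      t * (A * x ^ (-((2:ℝ) + 1))) + 20 * (B * x ^ (-((5 / 2 : ℝ) + 1)) +
        D * x ^ (-((8:ℝ) + 1))) := by
    have i2 : IntegrableOn (fun s : ℝ => t * (s ^ (2:ℝ) * Real.exp (-(x / 2 * s)))) (Ioi 0) :=
      (intg 2 (x / 2) (by norm_num) (by linarith)).const_mul t
    have i5 : IntegrableOn (fun s : ℝ => 20 * (s ^ (5 / 2 : ℝ) * Real.exp (-(x / 2 * s)) +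
        s ^ (8:ℝ) * Real.exp (-(x / 2 * s)))) (Ioi 0) :=
      ((intg (5 / 2) (x / 2) (by norm_num) (by linarith)).add
      (intg 8 (x / 2) (by norm_num) (by linarith))).const_mul 20
    rw [← intg_val 2 x (by norm_num) hx0, ← intg_val (5 / 2) x (by norm_num) hx0,
      ← intg_val 8 x (by norm_num) hx0,
      ← integral_add (intg (5 / 2) (x / 2) (by norm_num) (by linarith))
      (intg 8 (x / 2) (by norm_num) (by linarith)), ← integral_const_mul, ← integral_const_mul,
      ← integral_add i2 i5]
    refine integral_congr_ae (Eventually.of_forall fun s => ?_)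
    simp only [ee]; ring
  have x3 : ∀ p : ℝ, x ^ 3 * x ^ (-(p + 1)) = x ^ (2 - p) := by
    intro p
    rw [← Real.rpow_natCast, ← Real.rpow_add hx0]; congr 1; push_cast; ring
  have e2 : x ^ 3 * (t * (A * x ^ (-((2:ℝ) + 1))) + 20 * (B * x ^ (-((5 / 2 : ℝ) + 1)) +
        D * x ^ (-((8:ℝ) + 1)))) = t * A * (x ^ 3 * x ^ (-((2:ℝ) + 1)))
        + 20 * B * (x ^ 3 * x ^ (-((5 / 2 : ℝ) + 1))) + 20 * D * (x ^ 3 * x ^ (-((8:ℝ) + 1))) := by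
    ring
  rw [e, e2, x3, x3, x3]
  have h1 : x ^ ((2:ℝ) - 2) = 1 := by norm_num
  have h2 : x ^ ((2:ℝ) - 5 / 2) = x ^ (-(1 / 2) : ℝ) := by norm_num
  have h3 : x ^ ((2:ℝ) - 8) ≤ x ^ (-(1 / 2) : ℝ) :=
    Real.rpow_le_rpow_of_exponent_le hx (by norm_num)
  rw [h1, h2]
  have h4 : 0 ≤ x ^ (-(1 / 2) : ℝ) := by positivity
  nlinarith [mul_nonneg hB.le ht, mul_nonneg hD.le ht, mul_nonneg hA.le h4]

lemma differentiableAt_SS (a : ℝ) (ha : 0 < a) : DifferentiableAt ℝ SS a := by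
  unfold SS
  have : DifferentiableAt ℝ (fun a : ℝ => Real.Gamma (a + 1)) a := by
    have h : DifferentiableAt ℝ Real.Gamma (a + 1) := Real.differentiableAt_Gamma (fun m => by
      have : (0:ℝ) ≤ m := m.cast_nonneg
      linarith)
    exact DifferentiableAt.comp (g := Real.Gamma) (f := fun a : ℝ => a + 1) a h (by fun_prop)
  fun_prop

lemma fAlpha_asym : ∃ C : ℝ, 0 < C ∧ ∀ a b x : ℝ, (∀ᶠ a' in 𝓝 a, Good a') → |b| ≤ 1 → 1 ≤ x →
    |x ^ 3 * (Real.pi * fAlpha a b x - (1 + b) * (deriv SS a - SS a * Real.log x) *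
      x ^ (-(a + 1)))| ≤ C * (|tauP a| + x ^ (-(1 / 2) : ℝ)) := by
  obtain ⟨C, hC, h⟩ := err_int
  refine ⟨28 * C, by positivity, fun a b x haN hb hx => ?_⟩
  have ha := haN.self_of_nhds
  have hx0 : 0 < x := by linarith
  obtain ⟨i1, d1⟩ := hasDeriv_stable_a a b x haN hb hx0.le
  obtain ⟨i2, d2⟩ := int_kk_qa a b x haN hb hx0
  have d3 : HasDerivAt (fun a' => (1 + b) * SS a' * x ^ (-(a' + 1)))
      ((1 + b) * (deriv SS a - SS a * Real.log x) * x ^ (-(a + 1))) a := by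
    have h1 := (differentiableAt_SS a (by linarith [ha.lo])).hasDerivAt.const_mul (1 + b)
    have h2 : HasDerivAt (fun a' : ℝ => x ^ (-(a' + 1))) (Real.log x * -1 * x ^ (-(a + 1))) a := by
      have h0 : HasDerivAt (fun a' : ℝ => -(a' + 1)) (-1) a := ((hasDerivAt_id a).add_const 1).neg
      exact h0.const_rpow hx0
    refine (h1.mul h2).congr_deriv ?_
    ring
  rw [← d2.unique d3, fAlpha, d1.deriv]
  have e : Real.pi * (1 / Real.pi * (∫ s in Ioi (0:ℝ), kk x s *
      (Complex.exp (qq a b s) * qa a b s)).re) - (∫ s in Ioi (0:ℝ), kk x s * qa a b s).re =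
      (∫ s in Ioi (0:ℝ), kk x s * ((Complex.exp (qq a b s) - 1) * qa a b s)).re := by
    rw [← mul_assoc, mul_one_div_cancel Real.pi_ne_zero, one_mul, ← Complex.sub_re,
      ← integral_sub i1 i2]
    congr 2; ext s; ring
  rw [e, abs_mul, abs_of_pos (by positivity)]
  have hn : ‖∫ s in Ioi (0:ℝ), kk x s * ((Complex.exp (qq a b s) - 1) * qa a b s)‖ ≤
      28 * ∫ s in Ioi (0:ℝ), ee |tauP a| s * Real.exp (-(x / 2 * s)) := by
    rw [← integral_const_mul]
    refine norm_integral_le_of_norm_le ((intg_ee _ x hx0).const_mul _) (ae_Ioi fun s hs => ?_)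
    rw [← mul_assoc 28]
    refine norm_kk_mul x s _ _ hs ?_
    rw [norm_mul]
    have h1 := norm_exp_qq_sub_one a b s ha hb hs
    have h2 := norm_qq_le a b s ha hb hs
    have h3 := norm_qa a b s ha hb hs
    have h4 := prod_bound s |tauP a| hs (abs_nonneg _) (by linarith [ha.tau])
    have hw := ww_nonneg s hs
    calc _ ≤ (4 * (|tauP a| * s + 2 * ww s)) * (7 * (s + ww s)) :=
          mul_le_mul (by linarith) h3 (norm_nonneg _) (by positivity)
      _ = 28 * ((s + ww s) * (|tauP a| * s + 2 * ww s)) := by ring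
      _ ≤ _ := by unfold ee; linarith
  have h5 := h x |tauP a| hx (abs_nonneg _)
  have h6 := (Complex.abs_re_le_norm _).trans hn
  calc _ ≤ x ^ 3 * (28 * ∫ s in Ioi (0:ℝ), ee |tauP a| s * Real.exp (-(x / 2 * s))) := by gcongr
    _ ≤ _ := by linarith

lemma fBeta_asym : ∃ C : ℝ, 0 < C ∧ ∀ a b x : ℝ, Good a → |b| < 1 → 1 ≤ x →
    |x ^ 3 * (Real.pi * fBeta a b x - SS a * x ^ (-(a + 1)))| ≤
      C * |tauP a| * (|tauP a| + x ^ (-(1 / 2) : ℝ)) := by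
  obtain ⟨C, hC, h⟩ := err_int
  refine ⟨4 * C, by positivity, fun a b x ha hb hx => ?_⟩
  have hx0 : 0 < x := by linarith
  obtain ⟨i1, d1⟩ := hasDeriv_stable_b a b x ha hb hx0.le
  obtain ⟨i2, d2⟩ := int_kk_qb a x ha hx0
  rw [← d2, fBeta, d1.deriv]
  have e : Real.pi * (1 / Real.pi * (∫ s in Ioi (0:ℝ), kk x s *
      (Complex.exp (qq a b s) * qb a s)).re) - (∫ s in Ioi (0:ℝ), kk x s * qb a s).re =
      (∫ s in Ioi (0:ℝ), kk x s * ((Complex.exp (qq a b s) - 1) * qb a s)).re := by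
    rw [← mul_assoc, mul_one_div_cancel Real.pi_ne_zero, one_mul, ← Complex.sub_re,
      ← integral_sub i1 i2]
    congr 2; ext s; ring
  rw [e, abs_mul, abs_of_pos (by positivity)]
  have hn : ‖∫ s in Ioi (0:ℝ), kk x s * ((Complex.exp (qq a b s) - 1) * qb a s)‖ ≤
      4 * |tauP a| * ∫ s in Ioi (0:ℝ), ee |tauP a| s * Real.exp (-(x / 2 * s)) := by
    rw [← integral_const_mul]
    refine norm_integral_le_of_norm_le ((intg_ee _ x hx0).const_mul _) (ae_Ioi fun s hs => ?_)
    rw [← mul_assoc (4 * |tauP a|)]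
    refine norm_kk_mul x s _ _ hs ?_
    rw [norm_mul]
    have h1 := norm_exp_qq_sub_one a b s ha hb.le hs
    have h2 := norm_qq_le a b s ha hb.le hs
    have h3 := norm_qb a s ha hs
    have h4 := prod_bound s |tauP a| hs (abs_nonneg _) (by linarith [ha.tau])
    have hw := ww_nonneg s hs
    calc _ ≤ (4 * (|tauP a| * s + 2 * ww s)) * (|tauP a| * (s + ww s)) :=
          mul_le_mul (by linarith) h3 (norm_nonneg _) (by positivity)
      _ = 4 * |tauP a| * ((s + ww s) * (|tauP a| * s + 2 * ww s)) := by ring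
      _ ≤ _ := by unfold ee; gcongr
  have h5 := h x |tauP a| hx (abs_nonneg _)
  have h6 := (Complex.abs_re_le_norm _).trans hn
  calc _ ≤ x ^ 3 * (4 * |tauP a| * ∫ s in Ioi (0:ℝ), ee |tauP a| s * Real.exp (-(x / 2 * s))) := by
        gcongr
    _ = 4 * |tauP a| * (x ^ 3 * ∫ s in Ioi (0:ℝ), ee |tauP a| s * Real.exp (-(x / 2 * s))) := by
        ring
    _ ≤ 4 * |tauP a| * (C * (|tauP a| + x ^ (-(1 / 2) : ℝ))) := by gcongr
    _ = _ := by ring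

/-! ## Behaviour of the coefficients near exponent 2 -/

lemma good_near_two : ∀ᶠ a in 𝓝 (2:ℝ), Good a := by
  have hc : Real.cos (Real.pi * 2 / 2) ≠ 0 := by
    rw [show Real.pi * 2 / 2 = Real.pi by ring, Real.cos_pi]; norm_num
  have h1 : ∀ᶠ a in 𝓝 (2:ℝ), 19 / 10 ≤ a := le_mem_nhds (by norm_num)
  have h2 : ∀ᶠ a in 𝓝 (2:ℝ), a ≤ 21 / 10 := ge_mem_nhds (by norm_num)
  have h3 : ∀ᶠ a in 𝓝 (2:ℝ), |tauP a| < 1 / 8 := by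
    have : ContinuousAt (fun a => |tauP a|) 2 := by
      unfold tauP
      have : ContinuousAt (fun a : ℝ => Real.tan (Real.pi * a / 2)) 2 :=
        ContinuousAt.comp (f := fun a : ℝ => Real.pi * a / 2) (g := Real.tan)
          (Real.continuousAt_tan.2 hc) (by fun_prop)
      fun_prop
    refine this.eventually (gt_mem_nhds ?_)
    simp [tauP]
  have h4 : ∀ᶠ a in 𝓝 (2:ℝ), 3 / 8 < Real.cos (a * (Real.pi / 6)) := by
    have : ContinuousAt (fun a : ℝ => Real.cos (a * (Real.pi / 6))) 2 := by fun_prop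
    refine this.eventually (lt_mem_nhds ?_)
    show 3 / 8 < Real.cos (2 * (Real.pi / 6))
    rw [show 2 * (Real.pi / 6) = Real.pi / 3 by ring, Real.cos_pi_div_three]; norm_num
  have h5 : ∀ᶠ a in 𝓝 (2:ℝ), Real.cos (Real.pi * a / 2) ≠ 0 := by
    have : ContinuousAt (fun a : ℝ => Real.cos (Real.pi * a / 2)) 2 := by fun_prop
    exact this.eventually_ne hc
  filter_upwards [h1, h2, h3, h4, h5] with a a1 a2 a3 a4 a5
  exact ⟨a1, a2, a3.le, a4.le, a5⟩

lemma SS_two : SS 2 = 0 := by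
  rw [SS, show Real.pi * 2 / 2 = Real.pi by ring, Real.sin_pi, zero_mul]

lemma deriv_SS_two : deriv SS 2 = -Real.pi := by
  have h1 : HasDerivAt (fun a : ℝ => Real.sin (Real.pi * a / 2))
      (Real.cos (Real.pi * 2 / 2) * (Real.pi / 2)) 2 := by
    have : HasDerivAt (fun a : ℝ => Real.pi * a / 2) (Real.pi / 2) 2 := by
      simpa using ((hasDerivAt_id (2:ℝ)).const_mul Real.pi).div_const 2
    exact this.sin
  have h2 : DifferentiableAt ℝ (fun a : ℝ => Real.Gamma (a + 1)) 2 := by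
    have h : DifferentiableAt ℝ Real.Gamma (2 + 1) := Real.differentiableAt_Gamma (fun m => by
      have : (0:ℝ) ≤ m := m.cast_nonneg
      linarith)
    exact DifferentiableAt.comp (g := Real.Gamma) (f := fun a : ℝ => a + 1) 2 h (by fun_prop)
  have h3 := (h1.mul h2.hasDerivAt).deriv
  have h4 : deriv SS 2 = deriv ((fun a : ℝ => Real.sin (Real.pi * a / 2)) *
    fun a => Real.Gamma (a + 1)) 2 := rfl
  rw [h4, h3, show Real.pi * 2 / 2 = Real.pi by ring, Real.sin_pi, Real.cos_pi,
    show (2:ℝ) + 1 = (2:ℕ) + 1 by norm_num, Real.Gamma_nat_eq_factorial]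
  norm_num

lemma analyticAt_SS : AnalyticAt ℝ SS 2 := by
  have h1 : AnalyticAt ℂ Complex.Gamma ((3:ℝ) : ℂ) := by
    rw [Complex.analyticAt_iff_eventually_differentiableAt]
    have : ∀ᶠ z : ℂ in 𝓝 ((3:ℝ) : ℂ), 0 < z.re :=
      Complex.continuous_re.continuousAt.eventually (lt_mem_nhds (by norm_num))
    filter_upwards [this] with z hz
    refine Complex.differentiableAt_Gamma z fun m hm => ?_
    rw [hm] at hz
    simp at hz
    have : (0:ℝ) ≤ m := m.cast_nonneg
    linarith
  have h2 : AnalyticAt ℝ Real.Gamma 3 := by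
    have := h1.re_ofReal
    refine this.congr (Eventually.of_forall fun x => ?_)
    simp [Complex.Gamma_ofReal]
  have h3 : AnalyticAt ℝ (fun a : ℝ => Real.Gamma (a + 1)) 2 := by
    refine AnalyticAt.fun_comp (g := Real.Gamma) (f := fun a : ℝ => a + 1) ?_ (by fun_prop)
    norm_num; exact h2
  have h4 : AnalyticAt ℝ (fun a : ℝ => Real.sin (Real.pi * a / 2)) 2 := by fun_prop
  exact h4.mul h3

lemma deriv_SS_near : ∃ C : ℝ, 0 < C ∧ ∀ᶠ a in 𝓝 (2:ℝ), |deriv SS a + Real.pi| ≤ C * |a - 2| := by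
  have h := analyticAt_SS.deriv.differentiableAt.isBigO_sub
  obtain ⟨C, hC, h⟩ := h.exists_pos
  refine ⟨C, hC, ?_⟩
  filter_upwards [h.bound] with a ha
  rw [deriv_SS_two, sub_neg_eq_add] at ha
  simpa using ha

/-! ## The Gaussian limit and uniform packaging of the estimates -/

lemma stable_two (b x : ℝ) : stableDensity 2 b x = normalDensity x := by
  have ht : Real.tan (Real.pi * 2 / 2) = 0 := by
    rw [show Real.pi * 2 / 2 = Real.pi by ring, Real.tan_pi]
  have hgint : Integrable (fun t : ℝ => Complex.exp (Complex.I * (-x : ℝ) * t) *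
      Complex.exp (-1 * (t:ℂ) ^ 2)) := by
    have := GaussianFourier.integrable_cexp_neg_mul_sq_add_real_mul_I (b := 1) (by simp) 0
    have h1 : Integrable (fun t : ℝ => Real.exp (-1 * t ^ 2)) :=
      integrable_exp_neg_mul_sq one_pos
    refine h1.mono' (by fun_prop) (Eventually.of_forall fun t => ?_)
    rw [norm_mul, Complex.norm_exp, Complex.norm_exp]
    simp [← Complex.ofReal_pow]
  have e1 : ∫ t in Set.Ioi (0 : ℝ),
      Complex.exp (-(Complex.I * (t : ℂ) * (x : ℂ))) *
        Complex.exp (-(((t ^ (2:ℝ) : ℝ) : ℂ)) *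
          (1 + Complex.I * (b : ℂ) * ((Real.tan (Real.pi * 2 / 2) : ℝ) : ℂ) *
            (((t ^ (1 - 2 : ℝ) : ℝ) : ℂ) - 1))) =
      ∫ t in Set.Ioi (0 : ℝ), Complex.exp (Complex.I * (-x : ℝ) * t) *
        Complex.exp (-1 * (t:ℂ) ^ 2) := by
    refine setIntegral_congr_fun measurableSet_Ioi fun t _ => ?_
    simp only [ht, Real.rpow_two]
    congr 2
    · push_cast; ring
    · push_cast; ring
  have re : ∀ t : ℝ, (Complex.exp (Complex.I * (-x : ℝ) * t) *
      Complex.exp (-1 * (t:ℂ) ^ 2)).re = Real.cos (x * t) * Real.exp (-t ^ 2) := by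
    intro t
    have : Complex.exp (-1 * (t:ℂ) ^ 2) = (Real.exp (-t ^ 2) : ℂ) := by push_cast; ring_nf
    rw [this, Complex.re_mul_ofReal, Complex.exp_re]
    simp
  have e2 : (∫ t in Set.Ioi (0 : ℝ), Complex.exp (Complex.I * (-x : ℝ) * t) *
        Complex.exp (-1 * (t:ℂ) ^ 2)).re =
      ∫ t in Set.Ioi (0 : ℝ), Real.cos (x * t) * Real.exp (-t ^ 2) := by
    have h := integral_re (𝕜 := ℂ) (hgint.integrableOn (s := Ioi 0))
    simp only [RCLike.re_eq_complex_re] at h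
    rw [← h]
    exact setIntegral_congr_fun measurableSet_Ioi fun t _ => re t
  have e3 : (∫ t : ℝ, Complex.exp (Complex.I * (-x : ℝ) * t) *
        Complex.exp (-1 * (t:ℂ) ^ 2)).re = ∫ t : ℝ, Real.cos (x * t) * Real.exp (-t ^ 2) := by
    have h := integral_re (𝕜 := ℂ) hgint
    simp only [RCLike.re_eq_complex_re] at h
    rw [← h]
    exact integral_congr_ae (Eventually.of_forall fun t => re t)
  have e4 : ∫ t : ℝ, Real.cos (x * t) * Real.exp (-t ^ 2) =
      2 * ∫ t in Set.Ioi (0 : ℝ), Real.cos (x * t) * Real.exp (-t ^ 2) := by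
    rw [← integral_comp_abs (f := fun t => Real.cos (x * t) * Real.exp (-t ^ 2))]
    refine integral_congr_ae (Eventually.of_forall fun t => ?_)
    rcases abs_cases t with ⟨h, _⟩ | ⟨h, _⟩ <;> simp [h]
  have e5 := fourierIntegral_gaussian (b := 1) (by simp) ((-x : ℝ) : ℂ)
  rw [stableDensity, e1, e2, normalDensity]
  have e6 : (∫ t : ℝ, Complex.exp (Complex.I * (-x : ℝ) * t) *
        Complex.exp (-1 * (t:ℂ) ^ 2)).re = Real.sqrt Real.pi * Real.exp (-(x ^ 2) / 4) := by
    rw [e5, div_one]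
    have : (Real.pi : ℂ) ^ (1 / 2 : ℂ) = ((Real.sqrt Real.pi : ℝ) : ℂ) := by
      rw [Real.sqrt_eq_rpow, Complex.ofReal_cpow Real.pi_pos.le]; push_cast; rfl
    rw [this, Complex.re_ofReal_mul]
    congr 1
    rw [← Complex.ofReal_re (Real.exp (-(x ^ 2) / 4))]
    congr 1
    push_cast; ring_nf
  have e7 : ∫ t in Set.Ioi (0 : ℝ), Real.cos (x * t) * Real.exp (-t ^ 2) =
      Real.sqrt Real.pi * Real.exp (-(x ^ 2) / 4) / 2 := by linarith
  rw [e7]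
  have hs := Real.mul_self_sqrt Real.pi_pos.le
  have hp := Real.sqrt_pos.2 Real.pi_pos
  nth_rewrite 1 [← hs]
  field_simp

lemma near_two : ∃ d C : ℝ, 0 < d ∧ d ≤ 1 / 10 ∧ 0 < C ∧ C * d ≤ 1 ∧ ∀ a, |a - 2| < d →
    (∀ᶠ a' in 𝓝 a, Good a') ∧ |deriv SS a + Real.pi| ≤ C * |a - 2| := by
  obtain ⟨C, hC, h⟩ := deriv_SS_near
  obtain ⟨r, hr, hb⟩ := Metric.eventually_nhds_iff_ball.1 (good_near_two.and h)
  have h1 : min r (min (1 / 10) (1 / C)) ≤ 1 / C := (min_le_right _ _).trans (min_le_right _ _)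
  refine ⟨min r (min (1 / 10) (1 / C)), C, by positivity, (min_le_right _ _).trans (min_le_left _ _),
    hC, ?_, fun a ha => ?_⟩
  · calc C * _ ≤ C * (1 / C) := by gcongr
      _ = 1 := by field_simp
  · have ha' : a ∈ Metric.ball (2:ℝ) r := by
      rw [Metric.mem_ball, Real.dist_eq]; exact ha.trans_le (min_le_left _ _)
    refine ⟨?_, (hb a ha').2⟩
    filter_upwards [Metric.isOpen_ball.mem_nhds ha'] with a' h' using (hb a' h').1

lemma tau_bound (d : ℝ) (hG : ∀ a, |a - 2| < d → Good a) (δ : ℝ) (h0 : 0 < δ) (hd : δ < d) :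
    |tauP (2 - δ)| ≤ 2 * δ := by
  have hs : ∀ a ∈ Icc (2 - δ) 2, |a - 2| < d := fun a ha => by
    rw [abs_lt]; constructor <;> linarith [ha.1, ha.2]
  have := Convex.norm_image_sub_le_of_norm_hasDerivWithin_le (f := tauP) (f' := tauD)
    (s := Icc (2 - δ) 2) (C := 2) (x := 2) (y := 2 - δ)
    (fun a ha => (hasDerivAt_tauP a (hG a (hs a ha))).hasDerivWithinAt)
    (fun a ha => tauD_abs a (hG a (hs a ha))) (convex_Icc _ _)
    ⟨by linarith, le_rfl⟩ ⟨le_rfl, by linarith⟩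
  have t2 : tauP 2 = 0 := by simp [tauP]
  rw [t2, sub_zero, Real.norm_eq_abs, Real.norm_eq_abs, show 2 - δ - 2 = -δ by ring, abs_neg,
    abs_of_pos h0] at this
  exact this

lemma SS_bound (d C : ℝ) (hd1 : d ≤ 1 / 10) (hC : 0 < C)
    (hG : ∀ a, |a - 2| < d → |deriv SS a + Real.pi| ≤ C * |a - 2|)
    (δ : ℝ) (h0 : 0 < δ) (hd : δ < d) :
    |SS (2 - δ) - Real.pi * δ| ≤ C * δ * δ := by
  have hs : ∀ a ∈ Icc (2 - δ) 2, |a - 2| < d := fun a ha => by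
    rw [abs_lt]; constructor <;> linarith [ha.1, ha.2]
  have := Convex.norm_image_sub_le_of_norm_hasDerivWithin_le
    (f := fun a => SS a + Real.pi * a) (f' := fun a => deriv SS a + Real.pi)
    (s := Icc (2 - δ) 2) (C := C * δ) (x := 2) (y := 2 - δ)
    (fun a ha => by
      have h1 := (differentiableAt_SS a (by linarith [ha.1])).hasDerivAt
      have h2 : HasDerivAt (fun a : ℝ => Real.pi * a) Real.pi a := by
        simpa using (hasDerivAt_id a).const_mul Real.pi
      exact (h1.add h2).hasDerivWithinAt)
    (fun a ha => (hG a (hs a ha)).trans (by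
      have : |a - 2| ≤ δ := by rw [abs_le]; constructor <;> linarith [ha.1, ha.2]
      gcongr)) (convex_Icc _ _)
    ⟨by linarith, le_rfl⟩ ⟨le_rfl, by linarith⟩
  rw [SS_two, Real.norm_eq_abs, Real.norm_eq_abs, show 2 - δ - 2 = -δ by ring, abs_neg,
    abs_of_pos h0, show SS (2 - δ) + Real.pi * (2 - δ) - (0 + Real.pi * 2) =
    SS (2 - δ) - Real.pi * δ by ring] at this
  exact this

noncomputable def er (δ x : ℝ) : ℝ := δ * (1 + Real.log x) * x ^ δ + x ^ (-(1 / 2) : ℝ)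

lemma er_mono (δ ξ x : ℝ) (hx : 1 ≤ x) (h0 : 0 < ξ) (h : ξ ≤ δ) : er ξ x ≤ er δ x := by
  unfold er
  have := Real.log_nonneg hx
  have h2 : x ^ ξ ≤ x ^ δ := Real.rpow_le_rpow_of_exponent_le hx h
  have hd : 0 < δ := h0.trans_le h
  gcongr

lemma rpow_facts (δ x : ℝ) (hx : 1 ≤ x) (h0 : 0 < δ) : 1 ≤ x ^ δ ∧
    x ^ δ - 1 ≤ δ * Real.log x * x ^ δ ∧ x ^ 3 * x ^ (-(2 - δ + 1)) = x ^ δ := by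
  have hx0 : 0 < x := by linarith
  refine ⟨Real.one_le_rpow hx h0.le, ?_, ?_⟩
  · have h1 : x ^ δ = Real.exp (δ * Real.log x) := by
      rw [Real.rpow_def_of_pos hx0, mul_comm]
    have h2 := Real.add_one_le_exp (-(δ * Real.log x))
    rw [h1]
    set u := δ * Real.log x
    have h3 : Real.exp (-u) * Real.exp u = 1 := by rw [← Real.exp_add]; simp
    nlinarith [Real.exp_pos u]
  · rw [← Real.rpow_natCast, ← Real.rpow_add hx0]; congr 1; push_cast; ring

/-- The numerical core for the exponent derivative. -/
lemma core_A (C δ S S' y X : ℝ) (hC : 0 < C) (h0 : 0 < δ) (h1 : C * δ ≤ 1) (hy : 0 ≤ y)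
    (hX : 1 ≤ X) (hX2 : X - 1 ≤ δ * y * X) (hS : |S - Real.pi * δ| ≤ C * δ * δ)
    (hS' : |S' + Real.pi| ≤ C * δ) :
    |(S' - S * y) * X + Real.pi| ≤ (C + 9) * (δ * (1 + y) * X) ∧
    |S * X - Real.pi * δ| ≤ (C + 4) * δ * (δ * (1 + y) * X) ∧ Real.pi / 2 ≤ -((S' - S * y) * X) := by
  have hp := Real.pi_gt_three
  have hp4 := Real.pi_le_four
  obtain ⟨s1, s2⟩ := abs_le.1 hS
  obtain ⟨t1, t2⟩ := abs_le.1 hS'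
  have hCd : C * δ * δ ≤ δ := by nlinarith
  have hS0 : 0 ≤ S := by nlinarith
  have hS5 : S ≤ 5 * δ := by nlinarith
  have hSy : S * y * X ≤ 5 * (δ * y * X) := by
    have : 0 ≤ y * X := by positivity
    nlinarith
  have hSy0 : 0 ≤ S * y * X := by positivity
  have hdX : 0 ≤ δ * X := by positivity
  have hdyX : 0 ≤ δ * y * X := by positivity
  have c1 : 0 ≤ C * (δ * y * X) := by positivity
  have k1 : (S' + Real.pi) * X ≤ C * δ * X := by gcongr
  have k2 : -(C * δ) * X ≤ (S' + Real.pi) * X := by gcongr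
  have k3 : Real.pi * (X - 1) ≤ 4 * (δ * y * X) := by
    have : 0 ≤ X - 1 := by linarith
    nlinarith
  have k4 : 0 ≤ Real.pi * (X - 1) := mul_nonneg (by linarith) (by linarith)
  refine ⟨?_, ?_, ?_⟩
  · rw [abs_le]; constructor <;> nlinarith
  · have m1 : (S - Real.pi * δ) * X ≤ C * δ * δ * X := by gcongr
    have m2 : -(C * δ * δ) * X ≤ (S - Real.pi * δ) * X := by gcongr
    have m3 := mul_le_mul_of_nonneg_left k3 h0.le
    have m4 := mul_nonneg h0.le k4
    have m5 := mul_nonneg h0.le c1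
    have m6 := mul_nonneg h0.le hdX
    have e1 : S * X - Real.pi * δ = (S - Real.pi * δ) * X + δ * (Real.pi * (X - 1)) := by ring
    have e2 : (C + 4) * δ * (δ * (1 + y) * X) = C * δ * δ * X + δ * (C * (δ * y * X)) +
      4 * (δ * (δ * X)) + δ * (4 * (δ * y * X)) := by ring
    rw [e1, e2, abs_le]; constructor <;> linarith
  · have : S' - S * y ≤ -(Real.pi / 2) := by nlinarith [mul_nonneg hS0 hy]
    nlinarith

lemma core_num (A B C E M b δ U h F T : ℝ) (hA : 0 < A) (hB : 0 < B) (hC : 0 < C) (hE0 : 0 ≤ E)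
    (hM : M = 2 * (C + 9) + 2 * A + 4 * B + E + 1) (hb : |b| < 1) (h0 : 0 < δ) (hU : δ ≤ U)
    (hh : 0 ≤ h) (g3 : |Real.pi * F - (1 + b) * T| ≤ A * (2 * δ + h))
    (c1 : |T + Real.pi| ≤ (C + 9) * U) (c3 : Real.pi / 2 ≤ -T) :
    |F + (1 + b)| ≤ M * (U + h) ∧ F ≤ -((1 + b) / 2 - M * (δ + h)) := by
  have hp := Real.pi_gt_three
  have hM0 : 0 < M := by rw [hM]; positivity
  obtain ⟨b1, b2⟩ := abs_lt.1 hb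
  obtain ⟨g4, g5⟩ := abs_le.1 g3
  obtain ⟨c4, c5⟩ := abs_le.1 c1
  have hU0 : 0 ≤ U := h0.le.trans hU
  have hCU : 0 ≤ C * U := by positivity
  have hAU : A * δ ≤ A * U := by gcongr
  have hAh : 0 ≤ A * h := by positivity
  have hAd : 0 ≤ A * δ := by positivity
  have z1 : (1 + b) * (T + Real.pi) ≤ 2 * ((C + 9) * U) := by
    calc _ ≤ (1 + b) * ((C + 9) * U) := by gcongr; linarith
      _ ≤ _ := by
        have : 0 ≤ (C + 9) * U := by positivity
        nlinarith
  have z2 : -(2 * ((C + 9) * U)) ≤ (1 + b) * (T + Real.pi) := by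
    have : 0 ≤ (C + 9) * U := by positivity
    nlinarith
  have hMU : (2 * (C + 9) + 2 * A) * U + A * h ≤ M * (U + h) := by
    rw [hM]
    have : 0 ≤ B * U := by positivity
    have : 0 ≤ B * h := by positivity
    have : 0 ≤ C * h := by positivity
    have : 0 ≤ E * U := by positivity
    have : 0 ≤ E * h := by positivity
    linarith
  have hMh : 2 * (A * δ) + A * h ≤ M * (δ + h) := by
    rw [hM]
    have : 0 ≤ B * δ := by positivity
    have : 0 ≤ B * h := by positivity
    have : 0 ≤ C * h := by positivity
    have : 0 ≤ C * δ := by positivity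
    have : 0 ≤ E * δ := by positivity
    have : 0 ≤ E * h := by positivity
    linarith
  constructor
  · have w : |Real.pi * (F + (1 + b))| ≤ (2 * (C + 9) + 2 * A) * U + A * h := by
      rw [abs_le]; constructor <;> linarith
    rw [abs_mul, abs_of_pos Real.pi_pos] at w
    have : |F + (1 + b)| ≤ Real.pi * |F + (1 + b)| := by
      nlinarith [abs_nonneg (F + (1 + b))]
    linarith
  · have z3 : (1 + b) * (Real.pi / 2) ≤ (1 + b) * -T := by gcongr; linarith
    have w : Real.pi * (F + (1 + b) / 2) ≤ M * (δ + h) := by linarith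
    by_cases q : F + (1 + b) / 2 ≤ 0
    · have : 0 ≤ M * (δ + h) := by positivity
      linarith
    · nlinarith

lemma pack : ∃ d C : ℝ, 0 < d ∧ d ≤ 1 / 10 ∧ 0 < C ∧ ∀ δ b x : ℝ, 0 < δ → δ < d → |b| < 1 →
    (0 ≤ x → |fAlpha (2 - δ) b x| ≤ C ∧ |fBeta (2 - δ) b x| ≤ C * δ ∧
      |stableDensity (2 - δ) b x - normalDensity x| ≤ C * δ) ∧
    (1 ≤ x → |x ^ 3 * fAlpha (2 - δ) b x + (1 + b)| ≤ C * er δ x ∧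
      |x ^ 3 * fBeta (2 - δ) b x - δ| ≤ C * δ * er δ x ∧
      |x ^ 3 * (stableDensity (2 - δ) b x - normalDensity x) - δ * (1 + b)| ≤ C * δ * er δ x ∧
      δ * ((1 + b) / 2 - C * (δ + x ^ (-(1 / 2) : ℝ))) ≤
        x ^ 3 * (stableDensity (2 - δ) b x - normalDensity x)) := by
  obtain ⟨d, C, hd0, hd1, hC, hCd, hn⟩ := near_two
  obtain ⟨A, hA, hfA⟩ := fAlpha_asym
  obtain ⟨B, hB, hfB⟩ := fBeta_asym
  have hW := CW_nonneg
  have hp := Real.pi_gt_three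
  have hp4 := Real.pi_le_four
  have hG : ∀ a, |a - 2| < d → Good a := fun a ha => (hn a ha).1.self_of_nhds
  have hnear : ∀ δ : ℝ, 0 < δ → δ < d → |2 - δ - 2| < d := fun δ h0 h1 => by
    rw [show 2 - δ - 2 = -δ by ring, abs_neg, abs_of_pos h0]; exact h1
  set E := Real.exp 1 * 7 * CW with hE
  have hE0 : 0 ≤ E := by positivity
  have hE2 : Real.exp 1 * CW * 2 ≤ E := by
    have : 0 ≤ Real.exp 1 * CW := by positivity
    rw [hE]; nlinarith
  set M := 2 * (C + 9) + 2 * A + 4 * B + E + 1 with hM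
  have hM0 : 0 < M := by positivity
  -- estimates for the exponent derivative
  have keyA : ∀ δ b x : ℝ, 0 < δ → δ < d → |b| < 1 → 1 ≤ x →
      |x ^ 3 * fAlpha (2 - δ) b x + (1 + b)| ≤ M * er δ x ∧
      x ^ 3 * fAlpha (2 - δ) b x ≤ -((1 + b) / 2 - M * (δ + x ^ (-(1 / 2) : ℝ))) := by
    intro δ b x h0 h1 hb hx
    obtain ⟨f1, f2⟩ := hn (2 - δ) (hnear δ h0 h1)
    rw [show 2 - δ - 2 = -δ by ring, abs_neg, abs_of_pos h0] at f2
    have f3 := SS_bound d C hd1 hC (fun a ha => (hn a ha).2) δ h0 h1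
    have f4 := tau_bound d hG δ h0 h1
    obtain ⟨r1, r2, r3⟩ := rpow_facts δ x hx h0
    have hy := Real.log_nonneg hx
    obtain ⟨c1, -, c3⟩ := core_A C δ _ _ _ _ hC h0 (by nlinarith) hy r1 r2 f3 f2
    have g := hfA (2 - δ) b x f1 hb.le hx
    have e : x ^ 3 * (Real.pi * fAlpha (2 - δ) b x -
        (1 + b) * (deriv SS (2 - δ) - SS (2 - δ) * Real.log x) * x ^ (-(2 - δ + 1))) =
        Real.pi * (x ^ 3 * fAlpha (2 - δ) b x) -
        (1 + b) * ((deriv SS (2 - δ) - SS (2 - δ) * Real.log x) * x ^ δ) := by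
      rw [← r3]; ring
    rw [e] at g
    have hh : 0 ≤ x ^ (-(1 / 2) : ℝ) := by positivity
    have g2 : A * (|tauP (2 - δ)| + x ^ (-(1 / 2) : ℝ)) ≤ A * (2 * δ + x ^ (-(1 / 2) : ℝ)) := by
      gcongr
    have g3 := g.trans g2
    unfold er
    set F := x ^ 3 * fAlpha (2 - δ) b x
    set T := (deriv SS (2 - δ) - SS (2 - δ) * Real.log x) * x ^ δ
    set h := x ^ (-(1 / 2) : ℝ)
    set U := δ * (1 + Real.log x) * x ^ δ
    have hU : δ ≤ U := by
      calc δ = δ * (1 + 0) * 1 := by ring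
        _ ≤ U := by simp only [U]; gcongr
    exact core_num A B C E M b δ U h F T hA hB hC hE0 hM hb h0 hU hh g3 c1 c3
  have mvt : ∀ δ b x : ℝ, 0 < δ → δ < d → |b| < 1 → 0 ≤ x → ∃ ξ, 0 < ξ ∧ ξ < δ ∧
      stableDensity (2 - δ) b x - normalDensity x = -(δ * fAlpha (2 - ξ) b x) := by
    intro δ b x h0 h1 hb hx
    have hs : ∀ a ∈ Icc (2 - δ) 2, |a - 2| < d := fun a ha => by
      rw [abs_lt]; constructor <;> linarith [ha.1, ha.2]
    have hd : ∀ a ∈ Icc (2 - δ) 2, HasDerivAt (fun a' => stableDensity a' b x) (fAlpha a b x) a :=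
      fun a ha => (hasDeriv_stable_a a b x (hn a (hs a ha)).1 hb.le hx).2.differentiableAt.hasDerivAt
    obtain ⟨c, hc, he⟩ := exists_hasDerivAt_eq_slope (fun a' => stableDensity a' b x)
      (fun a => fAlpha a b x) (a := 2 - δ) (b := 2) (by linarith)
      (fun a ha => (hd a ha).continuousAt.continuousWithinAt)
      (fun a ha => hd a ⟨ha.1.le, ha.2.le⟩)
    refine ⟨2 - c, by linarith [hc.2], by linarith [hc.1], ?_⟩
    rw [show 2 - (2 - δ) = δ by ring, stable_two] at he
    rw [show 2 - (2 - c) = c by ring, he]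
    field_simp; ring
  refine ⟨d, M, hd0, hd1, hM0, fun δ b x h0 h1 hb => ⟨fun hx => ?_, fun hx => ?_⟩⟩
  · have f4 := tau_bound d hG δ h0 h1
    have hEM : E ≤ M := by rw [hM]; linarith
    refine ⟨(fAlpha_bdd _ b x (hn _ (hnear δ h0 h1)).1 hb.le hx).trans hEM,
      (fBeta_bdd _ b x (hG _ (hnear δ h0 h1)) hb hx).trans ?_, ?_⟩
    · calc _ ≤ Real.exp 1 * CW * (2 * δ) := by gcongr
        _ = (Real.exp 1 * CW * 2) * δ := by ring
        _ ≤ _ := by gcongr; linarith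
    · obtain ⟨ξ, x0, x1, he⟩ := mvt δ b x h0 h1 hb hx
      have := (fAlpha_bdd _ b x (hn _ (hnear ξ x0 (x1.trans h1))).1 hb.le hx).trans hEM
      rw [he, abs_neg, abs_mul, abs_of_pos h0, mul_comm]
      gcongr
  · refine ⟨(keyA δ b x h0 h1 hb hx).1, ?_, ?_⟩
    · obtain ⟨f1, f2⟩ := hn (2 - δ) (hnear δ h0 h1)
      rw [show 2 - δ - 2 = -δ by ring, abs_neg, abs_of_pos h0] at f2
      have f3 := SS_bound d C hd1 hC (fun a ha => (hn a ha).2) δ h0 h1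
      have f4 := tau_bound d hG δ h0 h1
      obtain ⟨r1, r2, r3⟩ := rpow_facts δ x hx h0
      have hy := Real.log_nonneg hx
      obtain ⟨-, c2, -⟩ := core_A C δ _ _ _ _ hC h0 (by nlinarith) hy r1 r2 f3 f2
      have g := hfB (2 - δ) b x f1.self_of_nhds hb hx
      have e : x ^ 3 * (Real.pi * fBeta (2 - δ) b x - SS (2 - δ) * x ^ (-(2 - δ + 1))) =
          Real.pi * (x ^ 3 * fBeta (2 - δ) b x) - SS (2 - δ) * x ^ δ := by
        rw [← r3]; ring
      rw [e] at g
      have hh : 0 ≤ x ^ (-(1 / 2) : ℝ) := by positivity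
      have g2 : B * |tauP (2 - δ)| * (|tauP (2 - δ)| + x ^ (-(1 / 2) : ℝ)) ≤
          B * (2 * δ) * (2 * δ + x ^ (-(1 / 2) : ℝ)) := by gcongr
      have g3 := g.trans g2
      unfold er
      set F := x ^ 3 * fBeta (2 - δ) b x
      set T := SS (2 - δ) * x ^ δ
      set h := x ^ (-(1 / 2) : ℝ)
      set U := δ * (1 + Real.log x) * x ^ δ
      have hU : δ ≤ U := by
        calc δ = δ * (1 + 0) * 1 := by ring
          _ ≤ U := by simp only [U]; gcongr
      have hU0 : 0 ≤ U := h0.le.trans hU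
      have g4 : B * (2 * δ) * (2 * δ + h) ≤ B * (2 * δ) * (2 * U + h) := by gcongr
      have w : |Real.pi * (F - δ)| ≤ M * δ * (U + h) := by
        calc |Real.pi * (F - δ)| = |(Real.pi * F - T) + (T - Real.pi * δ)| := by congr 1; ring
          _ ≤ |Real.pi * F - T| + |T - Real.pi * δ| := abs_add_le _ _
          _ ≤ B * (2 * δ) * (2 * U + h) + (C + 4) * δ * U := by linarith
          _ = δ * ((4 * B + (C + 4)) * U + 2 * B * h) := by ring
          _ ≤ δ * (M * U + M * h) := by gcongr <;> (rw [hM]; linarith)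
          _ = _ := by ring
      rw [abs_mul, abs_of_pos Real.pi_pos] at w
      nlinarith [abs_nonneg (F - δ)]
    · obtain ⟨ξ, x0, x1, he⟩ := mvt δ b x h0 h1 hb (by linarith)
      obtain ⟨k1, k2⟩ := keyA ξ b x x0 (x1.trans h1) hb hx
      have k3 := er_mono δ ξ x hx x0 x1.le
      rw [he]
      constructor
      · rw [show x ^ 3 * -(δ * fAlpha (2 - ξ) b x) - δ * (1 + b) =
          -(δ * (x ^ 3 * fAlpha (2 - ξ) b x + (1 + b))) by ring, abs_neg, abs_mul, abs_of_pos h0]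
        calc _ ≤ δ * (M * er δ x) := by
              apply mul_le_mul_of_nonneg_left _ h0.le
              exact k1.trans (by gcongr)
          _ = _ := by ring
      · rw [show x ^ 3 * -(δ * fAlpha (2 - ξ) b x) = δ * -(x ^ 3 * fAlpha (2 - ξ) b x) by ring]
        apply mul_le_mul_of_nonneg_left _ h0.le
        have : M * ξ ≤ M * δ := by gcongr
        nlinarith

/-! ## Pointwise bounds for the integrand on the half line -/

noncomputable def GG (δ b x : ℝ) : ℝ :=
  fAlpha (2 - δ) b x * fBeta (2 - δ) b x / stableDensity (2 - δ) b x

lemma normalDensity_pos (x : ℝ) : 0 < normalDensity x := by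
  unfold normalDensity
  have := Real.sqrt_pos.2 Real.pi_pos
  positivity

lemma normalDensity_anti (x y : ℝ) (h0 : 0 ≤ x) (h : x ≤ y) :
    normalDensity y ≤ normalDensity x := by
  unfold normalDensity
  have := Real.sqrt_pos.2 Real.pi_pos
  have h1 : x ^ 2 ≤ y ^ 2 := by gcongr
  gcongr

lemma er_nonneg (δ x : ℝ) (h0 : 0 < δ) (hx : 1 ≤ x) : 0 ≤ er δ x := by
  have := Real.log_nonneg hx
  unfold er; positivity

lemma core_G (C κ p A B F w e : ℝ) (hC : 0 < C) (hκ : 0 < κ) (hp0 : 0 ≤ p) (hp : p ≤ 2)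
    (he : 0 ≤ e) (hw : 0 ≤ w) (hA : |A + p| ≤ C * e) (hB : |B - 1| ≤ C * e)
    (hF : |F - w - p| ≤ C * e) (hF2 : κ / 4 ≤ F) :
    |A * B / F| ≤ 4 / κ * ((2 + C) * (1 + C)) * (1 + e) ^ 2 ∧
    |A * B / F + 1| ≤ 4 / κ * (4 * C + C ^ 2 + 1) * (e + e ^ 2 + w) := by
  have hF0 : 0 < F := by linarith [hκ]
  have hCe : 0 ≤ C * e := by positivity
  have hinv : ∀ z, 0 ≤ z → z / F ≤ 4 / κ * z := fun z hz => by
    rw [div_le_iff₀ hF0]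
    calc z = 4 / κ * z * (κ / 4) := by field_simp
      _ ≤ _ := by gcongr
  have hA2 : |A| ≤ 2 + C * e := by
    calc |A| = |(A + p) - p| := by congr 1; ring
      _ ≤ |A + p| + |p| := abs_sub _ _
      _ ≤ _ := by rw [abs_of_nonneg hp0]; linarith
  have hB2 : |B| ≤ 1 + C * e := by
    calc |B| = |(B - 1) + 1| := by congr 1; ring
      _ ≤ |B - 1| + |1| := abs_add_le _ _
      _ ≤ _ := by rw [abs_one]; linarith
  constructor
  · rw [abs_div, abs_of_pos hF0, abs_mul]
    refine (hinv _ (by positivity)).trans ?_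
    rw [mul_assoc (4 / κ)]
    apply mul_le_mul_of_nonneg_left _ (by positivity)
    calc |A| * |B| ≤ (2 + C * e) * (1 + C * e) := by gcongr
      _ ≤ ((2 + C) * (1 + e)) * ((1 + C) * (1 + e)) := by
        apply mul_le_mul _ _ (by positivity) (by positivity) <;> nlinarith
      _ = _ := by ring
  · have e1 : A * B / F + 1 = (A * B + F) / F := by field_simp
    rw [e1, abs_div, abs_of_pos hF0]
    refine (hinv _ (by positivity)).trans ?_
    rw [mul_assoc (4 / κ)]
    apply mul_le_mul_of_nonneg_left _ (by positivity)
    calc |A * B + F| = |(-(p * (B - 1)) + (A + p) * B) + ((F - w - p) + w)| := by congr 1; ring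
      _ ≤ (|p * (B - 1)| + |A + p| * |B|) + (|F - w - p| + |w|) := by
        refine (abs_add_le _ _).trans (add_le_add ((abs_add_le _ _).trans ?_) (abs_add_le _ _))
        rw [abs_neg, abs_mul (A + p)]
      _ ≤ (2 * (C * e) + (C * e) * (1 + C * e)) + (C * e + w) := by
        rw [abs_mul p, abs_of_nonneg hp0, abs_of_nonneg hw]
        gcongr
      _ ≤ _ := by
        have : 0 ≤ C * e ^ 2 := by positivity
        have : 0 ≤ C * w := by positivity
        have : 0 ≤ C ^ 2 * w := by positivity
        have : 0 ≤ C ^ 2 * e := by positivity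
        have : 0 ≤ e ^ 2 := by positivity
        linarith

lemma G_main (κ : ℝ) (hκ : 0 < κ) : ∃ d K X0 : ℝ, 0 < d ∧ d ≤ 1 / 10 ∧ 0 < K ∧ 1 ≤ X0 ∧
    ∀ δ b x : ℝ, 0 < δ → δ < d → |b| ≤ 1 - κ →
      (0 ≤ x → |GG δ b x| ≤ K * (δ / normalDensity x)) ∧
      (X0 ≤ x → |x ^ 3 * GG δ b x| ≤ K * (1 + er δ x) ^ 2 ∧
        |x ^ 3 * GG δ b x + 1| ≤ K * (er δ x + er δ x ^ 2 + x ^ 3 * normalDensity x / δ)) := by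
  obtain ⟨d, C, hd, hd1, hC, hp⟩ := pack
  set X0 := max 1 ((8 * C / κ) ^ 2) with hX0
  have hX1 : 1 ≤ X0 := le_max_left _ _
  have hn0 := normalDensity_pos X0
  set K := 2 * C ^ 2 + 4 / κ * ((2 + C) * (1 + C)) + 4 / κ * (4 * C + C ^ 2 + 1) with hK
  refine ⟨min d (min (κ / (8 * C)) (normalDensity X0 / (2 * C))), K, X0, by positivity,
    (min_le_left _ _).trans hd1, by positivity, hX1, fun δ b x h0 h1 hb => ?_⟩
  have hδ1 : δ < d := h1.trans_le (min_le_left _ _)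
  have hδ2 : C * δ ≤ κ / 8 := by
    have : δ ≤ κ / (8 * C) := h1.le.trans ((min_le_right _ _).trans (min_le_left _ _))
    calc C * δ ≤ C * (κ / (8 * C)) := by gcongr
      _ = _ := by field_simp
  have hδ3 : C * δ ≤ normalDensity X0 / 2 := by
    have : δ ≤ normalDensity X0 / (2 * C) :=
      h1.le.trans ((min_le_right _ _).trans (min_le_right _ _))
    calc C * δ ≤ C * (normalDensity X0 / (2 * C)) := by gcongr
      _ = _ := by field_simp
  have hb1 : |b| < 1 := by linarith
  obtain ⟨b1, b2⟩ := abs_le.1 hb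
  obtain ⟨q1, q2⟩ := hp δ b x h0 hδ1 hb1
  have hn := normalDensity_pos x
  -- lower bound for large x
  have low : X0 ≤ x → δ * (κ / 4) ≤ x ^ 3 * (stableDensity (2 - δ) b x - normalDensity x) := by
    intro hx
    have hx1 : 1 ≤ x := hX1.trans hx
    refine le_trans ?_ (q2 hx1).2.2.2
    apply mul_le_mul_of_nonneg_left _ h0.le
    have hs : 8 * C / κ ≤ Real.sqrt x := by
      apply Real.le_sqrt_of_sq_le
      exact (le_max_right _ _).trans hx
    have hr : x ^ (-(1 / 2) : ℝ) = 1 / Real.sqrt x := by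
      rw [Real.rpow_neg (by linarith), ← Real.sqrt_eq_rpow, one_div]
    have hs0 : 0 < Real.sqrt x := Real.sqrt_pos.2 (by linarith)
    have : C * x ^ (-(1 / 2) : ℝ) ≤ κ / 8 := by
      rw [hr, mul_one_div, div_le_iff₀ hs0]
      calc C = κ / 8 * (8 * C / κ) := by field_simp
        _ ≤ _ := by gcongr
    linarith
  have K1 : 0 ≤ 4 / κ * ((2 + C) * (1 + C)) := by positivity
  have K2 : 0 ≤ 4 / κ * (4 * C + C ^ 2 + 1) := by positivity
  constructor
  · intro hx
    obtain ⟨r1, r2, r3⟩ := q1 hx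
    have hf : normalDensity x / 2 ≤ stableDensity (2 - δ) b x := by
      rcases le_total X0 x with h | h
      · have := low h
        have hx3 : 0 < x ^ 3 := by have := hX1.trans h; positivity
        have h5 : 0 < δ * (κ / 4) := by positivity
        have : 0 < stableDensity (2 - δ) b x - normalDensity x :=
          (mul_pos_iff_of_pos_left hx3).1 (h5.trans_le this)
        linarith
      · have h5 := normalDensity_anti x X0 hx h
        have := (abs_le.1 r3).1
        linarith
    have hf0 : 0 < stableDensity (2 - δ) b x := by linarith
    unfold GG
    rw [abs_div, abs_of_pos hf0, abs_mul, div_le_iff₀ hf0]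
    calc _ ≤ C * (C * δ) := by gcongr
      _ = 2 * C ^ 2 * (δ / normalDensity x) * (normalDensity x / 2) := by field_simp
      _ ≤ K * (δ / normalDensity x) * stableDensity (2 - δ) b x := by
        gcongr; linarith
  · intro hx
    have hx1 : 1 ≤ x := hX1.trans hx
    obtain ⟨r1, r2, r3, -⟩ := q2 hx1
    have hx3 : 0 < x ^ 3 := by positivity
    have l := low hx
    have he := er_nonneg δ x h0 hx1
    set e := er δ x
    have key := core_G C κ (1 + b) (x ^ 3 * fAlpha (2 - δ) b x) (x ^ 3 * fBeta (2 - δ) b x / δ)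
      (x ^ 3 * stableDensity (2 - δ) b x / δ) (x ^ 3 * normalDensity x / δ) e hC hκ
      (by linarith) (by linarith) he (by positivity) r1
      (by
        have e1 : x ^ 3 * fBeta (2 - δ) b x / δ - 1 = (x ^ 3 * fBeta (2 - δ) b x - δ) / δ := by
          field_simp
        rw [e1, abs_div, abs_of_pos h0, div_le_iff₀ h0]
        linarith)
      (by
        have e1 : x ^ 3 * stableDensity (2 - δ) b x / δ - x ^ 3 * normalDensity x / δ - (1 + b) =
          (x ^ 3 * (stableDensity (2 - δ) b x - normalDensity x) - δ * (1 + b)) / δ := by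
          field_simp
        rw [e1, abs_div, abs_of_pos h0, div_le_iff₀ h0]
        linarith)
      (by
        rw [le_div_iff₀ h0]
        have : 0 < x ^ 3 * normalDensity x := by positivity
        linarith)
    have hGe : x ^ 3 * fAlpha (2 - δ) b x * (x ^ 3 * fBeta (2 - δ) b x / δ) /
        (x ^ 3 * stableDensity (2 - δ) b x / δ) = x ^ 3 * GG δ b x := by
      unfold GG
      have : stableDensity (2 - δ) b x ≠ 0 := by
        have h5 : 0 < δ * (κ / 4) := by positivity
        have : 0 < stableDensity (2 - δ) b x - normalDensity x :=
          (mul_pos_iff_of_pos_left hx3).1 (h5.trans_le l)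
        linarith
      field_simp
    rw [hGe] at key
    have hw : 0 ≤ x ^ 3 * normalDensity x / δ := by positivity
    refine ⟨key.1.trans ?_, key.2.trans ?_⟩
    · gcongr; rw [hK]; nlinarith [sq_nonneg C]
    · gcongr; rw [hK]; nlinarith [sq_nonneg C]

/-! ## Reflection -/

lemma stable_neg (a b x : ℝ) : stableDensity a b (-x) = stableDensity a (-b) x := by
  unfold stableDensity
  congr 1
  rw [← Complex.conj_re, ← integral_conj]
  congr 2
  ext t
  rw [map_mul, ← Complex.exp_conj, ← Complex.exp_conj]
  simp [-Complex.ofReal_tan]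

lemma GG_neg (δ b x : ℝ) : GG δ b (-x) = -GG δ (-b) x := by
  have h1 : fAlpha (2 - δ) b (-x) = fAlpha (2 - δ) (-b) x := by
    unfold fAlpha; simp only [stable_neg]
  have h2 : fBeta (2 - δ) b (-x) = -fBeta (2 - δ) (-b) x := by
    unfold fBeta; simp only [stable_neg]
    exact deriv_comp_neg (f := fun b => stableDensity (2 - δ) b x) b
  unfold GG
  rw [h1, h2, stable_neg]; ring

/-! ## Elementary estimates -/

lemma er_small (δ s x : ℝ) (h0 : 0 < δ) (h1 : δ ≤ 1) (hs : 1 ≤ s) (hx : s ≤ x) (hx2 : x ≤ s ^ 4) :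
    er δ x ≤ 2 * (s ^ 8 * δ) + s ^ (-(1 / 2) : ℝ) := by
  have hx1 : 1 ≤ x := hs.trans hx
  have hx0 : 0 < x := by linarith
  unfold er
  have a1 : x ^ (-(1 / 2) : ℝ) ≤ s ^ (-(1 / 2) : ℝ) :=
    Real.rpow_le_rpow_of_nonpos (by linarith) hx (by norm_num)
  have a2 : x ^ δ ≤ x := by
    simpa using Real.rpow_le_rpow_of_exponent_le hx1 h1
  have a3 : 1 + Real.log x ≤ x := by linarith [Real.log_le_sub_one_of_pos hx0]
  have a4 := Real.log_nonneg hx1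
  have : δ * (1 + Real.log x) * x ^ δ ≤ δ * s ^ 4 * s ^ 4 := by
    calc _ ≤ δ * x * x := by gcongr
      _ ≤ _ := by gcongr
  have : 0 ≤ s ^ 8 * δ := by positivity
  nlinarith

lemma er_large (δ x : ℝ) (h0 : 0 < δ) (h1 : δ ≤ 1 / 10) (hx1 : 1 ≤ x) :
    (1 + er δ x) ^ 2 ≤ 49 * x := by
  have hx0 : 0 < x := by linarith
  have hs : x ^ (1 / 4 : ℝ) * x ^ (1 / 4 : ℝ) = Real.sqrt x := by
    rw [← Real.rpow_add hx0, Real.sqrt_eq_rpow]; norm_num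
  have a1 : 1 ≤ x ^ (1 / 4 : ℝ) := Real.one_le_rpow hx1 (by norm_num)
  have a2 : x ^ δ ≤ x ^ (1 / 4 : ℝ) := Real.rpow_le_rpow_of_exponent_le hx1 (by linarith)
  have a3 : Real.log x ≤ x ^ (1 / 4 : ℝ) / (1 / 4) := Real.log_le_rpow_div hx0.le (by norm_num)
  have a4 := Real.log_nonneg hx1
  have a5 : x ^ (-(1 / 2) : ℝ) ≤ 1 := Real.rpow_le_one_of_one_le_of_nonpos hx1 (by norm_num)
  have a6 : 1 ≤ Real.sqrt x := Real.one_le_sqrt.2 hx1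
  have he := er_nonneg δ x h0 hx1
  have : er δ x ≤ 6 * Real.sqrt x := by
    unfold er
    have : δ * (1 + Real.log x) * x ^ δ ≤ 1 * (5 * x ^ (1 / 4 : ℝ)) * x ^ (1 / 4 : ℝ) := by
      gcongr
      · linarith
      · linarith
    nlinarith
  calc (1 + er δ x) ^ 2 ≤ (7 * Real.sqrt x) ^ 2 := by gcongr; linarith
    _ = 49 * x := by rw [mul_pow, Real.sq_sqrt hx0.le]; norm_num

lemma delta_div_normal (s x : ℝ) (hs : 0 ≤ s) (hx : 0 ≤ x) (hx2 : x ≤ 2 * s - 1) :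
    Real.exp (-s ^ 2) / normalDensity x ≤ 4 * Real.exp (-(s / 2)) := by
  have hq := Real.sqrt_pos.2 Real.pi_pos
  have hq2 : Real.sqrt Real.pi ≤ 2 := by
    rw [Real.sqrt_le_left (by norm_num)]; linarith [Real.pi_le_four]
  rw [div_le_iff₀ (normalDensity_pos x), normalDensity]
  have h1 : Real.exp (-s ^ 2) ≤ Real.exp (-(s / 2)) * Real.exp (-(x ^ 2) / 4) := by
    rw [← Real.exp_add]
    apply Real.exp_le_exp.2
    nlinarith
  have h2 : 1 ≤ 4 * (1 / (2 * Real.sqrt Real.pi)) := by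
    rw [mul_one_div, le_div_iff₀ (by positivity)]; linarith
  calc _ ≤ 1 * (Real.exp (-(s / 2)) * Real.exp (-(x ^ 2) / 4)) := by rw [one_mul]; exact h1
    _ ≤ 4 * (1 / (2 * Real.sqrt Real.pi)) * (Real.exp (-(s / 2)) * Real.exp (-(x ^ 2) / 4)) := by
      gcongr
    _ = _ := by ring

lemma normal_div_delta (s x : ℝ) (hs : 1 ≤ s) (hx : 2 * s + 1 ≤ x) :
    x ^ 3 * normalDensity x / Real.exp (-s ^ 2) ≤ 3072 * Real.exp (-(s / 4)) := by
  have hx0 : 0 < x := by linarith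
  have hq : 1 ≤ Real.sqrt Real.pi := Real.one_le_sqrt.2 (by linarith [Real.pi_gt_three])
  have h2 : 1 / (2 * Real.sqrt Real.pi) ≤ 1 := by
    rw [div_le_one (by positivity)]; linarith
  rw [div_le_iff₀ (Real.exp_pos _), normalDensity]
  have h1 : Real.exp (-(x ^ 2) / 4) ≤ Real.exp (-(x / 4)) * Real.exp (-s ^ 2) := by
    rw [← Real.exp_add]
    apply Real.exp_le_exp.2
    nlinarith
  have h3 : x ^ 3 ≤ 3072 * Real.exp (x / 8) := by
    have := Real.pow_div_factorial_le_exp (x / 8) (by positivity) 3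
    have e : (x / 8) ^ 3 / (Nat.factorial 3 : ℝ) = x ^ 3 / 3072 := by
      norm_num [Nat.factorial]; ring
    rw [e] at this
    linarith
  have h4 : Real.exp (x / 8) * Real.exp (-(x / 4)) ≤ Real.exp (-(s / 4)) := by
    rw [← Real.exp_add]
    apply Real.exp_le_exp.2
    linarith
  calc _ ≤ (3072 * Real.exp (x / 8)) * (1 * (Real.exp (-(x / 4)) * Real.exp (-s ^ 2))) := by
        gcongr
    _ = 3072 * (Real.exp (x / 8) * Real.exp (-(x / 4))) * Real.exp (-s ^ 2) := by ring
    _ ≤ _ := by gcongr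

/-! ## The integrable majorant -/

noncomputable def HH (c1 c2 c3 c4 a b D x : ℝ) : ℝ :=
  (Ioc 0 a).indicator (fun _ => c1) x + (Ioc a b).indicator (fun _ => c2) x +
    (Ioi b).indicator (fun x => c3 * x ^ (-3 : ℝ)) x +
    (Ioi D).indicator (fun x => c4 * x ^ (-2 : ℝ)) x

lemma HH_int (c1 c2 c3 c4 a b D : ℝ) (ha : 0 ≤ a) (hab : a ≤ b) (hb : 0 < b) (hD : 0 < D) :
    Integrable (HH c1 c2 c3 c4 a b D) ∧
    ∫ x, HH c1 c2 c3 c4 a b D x = c1 * a + c2 * (b - a) + c3 * (b ^ (-2 : ℝ) / 2) +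
      c4 * D ^ (-1 : ℝ) := by
  have i1 : Integrable ((Ioc 0 a).indicator (fun _ : ℝ => c1)) :=
    (integrable_indicator_iff measurableSet_Ioc).2 (integrableOn_const (by simp))
  have i2 : Integrable ((Ioc a b).indicator (fun _ : ℝ => c2)) :=
    (integrable_indicator_iff measurableSet_Ioc).2 (integrableOn_const (by simp))
  have i3 : Integrable ((Ioi b).indicator (fun x : ℝ => c3 * x ^ (-3 : ℝ))) :=
    (integrable_indicator_iff measurableSet_Ioi).2
      ((integrableOn_Ioi_rpow_of_lt (by norm_num) hb).const_mul c3)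
  have i4 : Integrable ((Ioi D).indicator (fun x : ℝ => c4 * x ^ (-2 : ℝ))) :=
    (integrable_indicator_iff measurableSet_Ioi).2
      ((integrableOn_Ioi_rpow_of_lt (by norm_num) hD).const_mul c4)
  refine ⟨((i1.add i2).add i3).add i4, ?_⟩
  have e : ∫ x, HH c1 c2 c3 c4 a b D x = (∫ x, (Ioc 0 a).indicator (fun _ : ℝ => c1) x) +
      (∫ x, (Ioc a b).indicator (fun _ : ℝ => c2) x) +
      (∫ x, (Ioi b).indicator (fun x : ℝ => c3 * x ^ (-3 : ℝ)) x) +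
      ∫ x, (Ioi D).indicator (fun x : ℝ => c4 * x ^ (-2 : ℝ)) x := by
    rw [← integral_add i1 i2]
    have k2 := integral_add (i1.add i2) i3
    have k3 := integral_add ((i1.add i2).add i3) i4
    simp only [Pi.add_apply] at k2 k3
    rw [← k2, ← k3]
    rfl
  rw [e, integral_indicator measurableSet_Ioc, integral_indicator measurableSet_Ioc,
    integral_indicator measurableSet_Ioi, integral_indicator measurableSet_Ioi,
    integral_const_mul, integral_const_mul, integral_Ioi_rpow_of_lt (by norm_num) hb,
    integral_Ioi_rpow_of_lt (by norm_num) hD, setIntegral_const, setIntegral_const]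
  simp only [Real.volume_real_Ioc_of_le ha, Real.volume_real_Ioc_of_le hab, smul_eq_mul]
  norm_num
  ring

lemma HH_nonneg (c1 c2 c3 c4 a b D x : ℝ) (h1 : 0 ≤ c1) (h2 : 0 ≤ c2) (h3 : 0 ≤ c3) (h4 : 0 ≤ c4)
    (hx : 0 < x) (r : ℝ)
    (k1 : x ≤ a → r ≤ c1) (k2 : a < x → x ≤ b → r ≤ c2)
    (k3 : b < x → x ≤ D → r ≤ c3 * x ^ (-3 : ℝ)) (k4 : b < x → D < x → r ≤ c4 * x ^ (-2 : ℝ)) :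
    r ≤ HH c1 c2 c3 c4 a b D x := by
  have p3 : 0 ≤ c3 * x ^ (-3 : ℝ) := by positivity
  have p4 : 0 ≤ c4 * x ^ (-2 : ℝ) := by positivity
  have n1 : 0 ≤ (Ioc 0 a).indicator (fun _ => c1) x := indicator_apply_nonneg fun _ => h1
  have n2 : 0 ≤ (Ioc a b).indicator (fun _ => c2) x := indicator_apply_nonneg fun _ => h2
  have n3 : 0 ≤ (Ioi b).indicator (fun x => c3 * x ^ (-3 : ℝ)) x :=
    indicator_apply_nonneg fun _ => p3
  have n4 : 0 ≤ (Ioi D).indicator (fun x => c4 * x ^ (-2 : ℝ)) x :=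
    indicator_apply_nonneg fun _ => p4
  unfold HH
  by_cases q1 : x ≤ a
  · have : (Ioc 0 a).indicator (fun _ => c1) x = c1 := indicator_of_mem (show x ∈ Ioc 0 a from ⟨hx, q1⟩) _
    linarith [k1 q1]
  push Not at q1
  by_cases q2 : x ≤ b
  · have : (Ioc a b).indicator (fun _ => c2) x = c2 := indicator_of_mem (show x ∈ Ioc a b from ⟨q1, q2⟩) _
    linarith [k2 q1 q2]
  push Not at q2
  by_cases q3 : x ≤ D
  · have : (Ioi b).indicator (fun x => c3 * x ^ (-3 : ℝ)) x = c3 * x ^ (-3 : ℝ) :=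
      indicator_of_mem (show x ∈ Ioi b from q2) _
    linarith [k3 q2 q3]
  push Not at q3
  have : (Ioi D).indicator (fun x => c4 * x ^ (-2 : ℝ)) x = c4 * x ^ (-2 : ℝ) :=
      indicator_of_mem (show x ∈ Ioi D from q3) _
  linarith [k4 q2 q3]

/-- Control of an integral over the line by symmetrisation. -/
lemma abs_integral_le_symm (g H : ℝ → ℝ) (hH : Integrable H) (hH0 : ∀ x, 0 ≤ H x)
    (h : ∀ x, 0 < x → |g x + g (-x)| ≤ H x) : |∫ x, g x| ≤ ∫ x, H x := by
  by_cases hg : Integrable g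
  · have hg2 : Integrable (fun x => g (-x)) := hg.comp_neg
    have e : ∫ x, g x = ∫ x in Ioi (0:ℝ), (g x + g (-x)) := by
      rw [integral_add hg.integrableOn hg2.integrableOn, integral_comp_neg_Ioi, neg_zero, add_comm,
        intervalIntegral.integral_Iic_add_Ioi hg.integrableOn hg.integrableOn]
    rw [e]
    calc ‖∫ x in Ioi (0:ℝ), (g x + g (-x))‖ ≤ ∫ x in Ioi (0:ℝ), H x :=
          norm_integral_le_of_norm_le hH.integrableOn (ae_Ioi fun x hx => h x hx)
      _ ≤ _ := setIntegral_le_integral hH (Eventually.of_forall hH0)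
  · rw [integral_undef hg, abs_zero]
    exact integral_nonneg hH0

noncomputable def ep (s : ℝ) : ℝ := 2 * (s ^ 8 * Real.exp (-s ^ 2)) + s ^ (-(1 / 2) : ℝ)

noncomputable def ep3 (s : ℝ) : ℝ := ep s + ep s ^ 2 + 3072 * Real.exp (-(s / 4))

lemma tendsto_ep : Tendsto ep atTop (𝓝 0) := by
  have h1 : Tendsto (fun s : ℝ => s ^ 8 * Real.exp (-s ^ 2)) atTop (𝓝 0) := by
    have h2 := (Real.tendsto_pow_mul_exp_neg_atTop_nhds_zero 4).comp (tendsto_pow_atTop two_ne_zero)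
    refine h2.congr fun s => ?_
    simp only [Function.comp]; ring_nf
  have h3 := tendsto_rpow_neg_atTop (y := 1 / 2) (by norm_num)
  have h4 := (h1.const_mul 2).add h3
  rw [mul_zero, add_zero] at h4
  exact h4

lemma tendsto_exp_c (c : ℝ) (hc : 0 < c) : Tendsto (fun s => Real.exp (-(s / c))) atTop (𝓝 0) :=
  Real.tendsto_exp_neg_atTop_nhds_zero.comp (tendsto_id.atTop_div_const hc)

lemma tendsto_ep3 : Tendsto ep3 atTop (𝓝 0) := by
  have := (tendsto_ep.add (tendsto_ep.pow 2)).add ((tendsto_exp_c 4 (by norm_num)).const_mul 3072)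
  rw [mul_zero, zero_pow two_ne_zero, add_zero, add_zero] at this
  exact this

noncomputable def eta (s : ℝ) : ℝ :=
  2 * (s ^ 3 * Real.exp (-(s / 2))) + s⁻¹ + ep3 s + s⁻¹ ^ 2

lemma tendsto_eta : Tendsto eta atTop (𝓝 0) := by
  have h1 : Tendsto (fun s : ℝ => s ^ 3 * Real.exp (-(s / 2))) atTop (𝓝 0) := by
    have h2 := ((Real.tendsto_pow_mul_exp_neg_atTop_nhds_zero 3).comp
      (tendsto_id.atTop_div_const (r := (2:ℝ)) (by norm_num))).const_mul 8
    rw [mul_zero] at h2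
    refine h2.congr fun s => ?_
    simp only [Function.comp, id]; ring
  have h3 : Tendsto (fun s : ℝ => s⁻¹) atTop (𝓝 0) := tendsto_inv_atTop_zero
  have := (((h1.const_mul 2).add h3).add tendsto_ep3).add (h3.pow 2)
  rw [mul_zero, zero_pow two_ne_zero, add_zero, add_zero, add_zero] at this
  exact this

lemma main_bound (β : ℝ) (hβ : |β| < 1) : ∃ K : ℝ, 0 < K ∧ ∀ᶠ s : ℝ in atTop,
    |s ^ 2 * ∫ x, GG (Real.exp (-s ^ 2)) β x| ≤ K * eta s := by
  set κ := 1 - |β| with hκ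
  have hκ0 : 0 < κ := by linarith
  obtain ⟨d, K, X0, hd, hd1, hK, hX, hG⟩ := G_main κ hκ0
  refine ⟨200 * K, by positivity, ?_⟩
  have ev1 : ∀ᶠ s : ℝ in atTop, Real.exp (-s ^ 2) < d := by
    have : Tendsto (fun s : ℝ => Real.exp (-s ^ 2)) atTop (𝓝 0) :=
      Real.tendsto_exp_neg_atTop_nhds_zero.comp (tendsto_pow_atTop two_ne_zero)
    exact this.eventually (gt_mem_nhds hd)
  have ev2 : ∀ᶠ s : ℝ in atTop, ep s < 1 := tendsto_ep.eventually (gt_mem_nhds one_pos)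
  filter_upwards [ev1, ev2, eventually_ge_atTop X0, eventually_ge_atTop 2] with s s1 s2 s3 s4
  set δ := Real.exp (-s ^ 2) with hδ
  have h0 : 0 < δ := Real.exp_pos _
  have hs0 : 0 < s := by linarith
  have hs1 : 1 ≤ s := by linarith
  have hs44 : 2 * s + 1 ≤ s ^ 4 := by
    have : 4 ≤ s ^ 2 := by nlinarith
    nlinarith
  have hep0 : 0 ≤ ep s := by unfold ep; positivity
  have hep3 : 0 ≤ ep3 s := by unfold ep3; positivity
  -- individual pointwise bounds
  have B : ∀ b x : ℝ, |b| = |β| → 0 < x →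
      (x ≤ 2 * s - 1 → |GG δ b x| ≤ 4 * K * Real.exp (-(s / 2))) ∧
      (2 * s - 1 < x → x ≤ 2 * s + 1 → |GG δ b x| ≤ 4 * K * s⁻¹ ^ 3) ∧
      (2 * s + 1 < x → x ≤ s ^ 4 → |x ^ 3 * GG δ b x + 1| ≤ K * ep3 s) ∧
      (2 * s + 1 < x → |x ^ 3 * GG δ b x| ≤ K * (49 * x)) := by
    intro b x hb hx
    obtain ⟨g1, g2⟩ := hG δ b x h0 s1 (by rw [hb, hκ]; linarith)
    refine ⟨fun h => ?_, fun h h' => ?_, fun h h' => ?_, fun h => ?_⟩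
    · refine (g1 hx.le).trans ?_
      have := delta_div_normal s x hs0.le hx.le h
      calc _ ≤ K * (4 * Real.exp (-(s / 2))) := by gcongr
        _ = _ := by ring
    · have hsx : s ≤ x := by linarith
      have e1 := er_small δ s x h0 (by linarith) hs1 hsx (by linarith)
      have e2 : er δ x ≤ 1 := e1.trans s2.le
      have e3 := er_nonneg δ x h0 (by linarith)
      have := (g2 (by linarith)).1
      have hx3 : 0 < x ^ 3 := by positivity
      rw [abs_mul, abs_of_pos hx3] at this
      have h5 : s ^ 3 * |GG δ b x| ≤ 4 * K := by
        calc s ^ 3 * |GG δ b x| ≤ x ^ 3 * |GG δ b x| := by gcongr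
          _ ≤ K * (1 + er δ x) ^ 2 := this
          _ ≤ K * (1 + 1) ^ 2 := by gcongr
          _ = _ := by ring
      calc |GG δ b x| = (s ^ 3 * |GG δ b x|) * s⁻¹ ^ 3 := by field_simp
        _ ≤ _ := by gcongr
    · have hsx : s ≤ x := by linarith
      have e1 : er δ x ≤ ep s := er_small δ s x h0 (by linarith) hs1 hsx (by linarith)
      have e3 := er_nonneg δ x h0 (by linarith)
      have e4 := normal_div_delta s x hs1 h.le
      refine (g2 (by linarith)).2.trans ?_
      unfold ep3
      gcongr
    · refine (g2 (by linarith)).1.trans ?_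
      have := er_large δ x h0 (by linarith) (by linarith)
      gcongr
  have hmaj : ∀ x, 0 < x → |GG δ β x + GG δ β (-x)| ≤
      HH (8 * K * Real.exp (-(s / 2))) (8 * K * s⁻¹ ^ 3) (2 * K * ep3 s) (98 * K)
        (2 * s - 1) (2 * s + 1) (s ^ 4) x := by
    intro x hx
    rw [GG_neg, ← sub_eq_add_neg]
    obtain ⟨p1, p2, p3, p4⟩ := B β x rfl hx
    obtain ⟨m1, m2, m3, m4⟩ := B (-β) x (abs_neg β) hx
    have tri := abs_sub (GG δ β x) (GG δ (-β) x)
    have hx3 : 0 < x ^ 3 := by positivity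
    have r3 : x ^ (-3 : ℝ) = (x ^ 3)⁻¹ := by
      rw [Real.rpow_neg hx.le, ← Real.rpow_natCast]; norm_num
    have r2 : x ^ (-2 : ℝ) = x * (x ^ 3)⁻¹ := by
      rw [Real.rpow_neg hx.le, show (2:ℝ) = (2:ℕ) by norm_num, Real.rpow_natCast]; field_simp
    have tri3 : |GG δ β x - GG δ (-β) x| =
        |(x ^ 3 * GG δ β x + 1) - (x ^ 3 * GG δ (-β) x + 1)| * (x ^ 3)⁻¹ := by
      rw [show (x ^ 3 * GG δ β x + 1) - (x ^ 3 * GG δ (-β) x + 1) =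
        x ^ 3 * (GG δ β x - GG δ (-β) x) by ring, abs_mul, abs_of_pos hx3]
      field_simp
    have tri4 : |GG δ β x - GG δ (-β) x| =
        |x ^ 3 * GG δ β x - x ^ 3 * GG δ (-β) x| * (x ^ 3)⁻¹ := by
      rw [← mul_sub, abs_mul, abs_of_pos hx3]
      field_simp
    refine HH_nonneg _ _ _ _ _ _ _ x (by positivity) (by positivity) (by positivity)
      (by positivity) hx _ (fun h => ?_) (fun h h' => ?_) (fun h h' => ?_) (fun h h' => ?_)
    · linarith [p1 h, m1 h]
    · linarith [p2 h h', m2 h h']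
    · rw [tri3, r3]
      have := abs_sub (x ^ 3 * GG δ β x + 1) (x ^ 3 * GG δ (-β) x + 1)
      gcongr
      linarith [p3 h h', m3 h h']
    · rw [tri4, r2, ← mul_assoc]
      have := abs_sub (x ^ 3 * GG δ β x) (x ^ 3 * GG δ (-β) x)
      gcongr
      linarith [p4 h, m4 h]
  have c1 : 0 ≤ 8 * K * Real.exp (-(s / 2)) := by positivity
  have c2 : 0 ≤ 8 * K * s⁻¹ ^ 3 := by positivity
  have c3 : 0 ≤ 2 * K * ep3 s := by positivity
  have c4 : 0 ≤ 98 * K := by positivity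
  have hnn : ∀ x, 0 ≤ HH (8 * K * Real.exp (-(s / 2))) (8 * K * s⁻¹ ^ 3) (2 * K * ep3 s) (98 * K)
        (2 * s - 1) (2 * s + 1) (s ^ 4) x := by
    intro x
    unfold HH
    have n1 : 0 ≤ (Ioc 0 (2 * s - 1)).indicator (fun _ => 8 * K * Real.exp (-(s / 2))) x :=
      indicator_apply_nonneg fun _ => c1
    have n2 : 0 ≤ (Ioc (2 * s - 1) (2 * s + 1)).indicator (fun _ => 8 * K * s⁻¹ ^ 3) x :=
      indicator_apply_nonneg fun _ => c2
    have n3 : 0 ≤ (Ioi (2 * s + 1)).indicator (fun x => 2 * K * ep3 s * x ^ (-3 : ℝ)) x :=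
      indicator_apply_nonneg fun h => by
        have : 0 < x := lt_trans (by linarith) (mem_Ioi.1 h)
        positivity
    have n4 : 0 ≤ (Ioi (s ^ 4)).indicator (fun x => 98 * K * x ^ (-2 : ℝ)) x :=
      indicator_apply_nonneg fun h => by
        have : 0 < x := lt_trans (by positivity) (mem_Ioi.1 h)
        positivity
    linarith
  obtain ⟨hi, hv⟩ := HH_int (8 * K * Real.exp (-(s / 2))) (8 * K * s⁻¹ ^ 3) (2 * K * ep3 s) (98 * K)
        (2 * s - 1) (2 * s + 1) (s ^ 4) (by linarith) (by linarith) (by linarith) (by positivity)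
  have fin := abs_integral_le_symm (fun x => GG δ β x) _ hi hnn hmaj
  rw [hv] at fin
  rw [abs_mul, abs_of_pos (by positivity : 0 < s ^ 2)]
  have hb2 : (2 * s + 1) ^ (-2 : ℝ) ≤ s⁻¹ ^ 2 := by
    rw [Real.rpow_neg (by linarith), show (2:ℝ) = (2:ℕ) by norm_num, Real.rpow_natCast, inv_pow]
    push_cast
    gcongr
    linarith
  have hD : (s ^ 4) ^ (-1 : ℝ) = s⁻¹ ^ 4 := by
    rw [Real.rpow_neg_one, inv_pow]
  rw [hD] at fin
  calc s ^ 2 * |∫ x, GG δ β x| ≤ s ^ 2 * (8 * K * Real.exp (-(s / 2)) * (2 * s) +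
        8 * K * s⁻¹ ^ 3 * 2 + 2 * K * ep3 s * (s⁻¹ ^ 2 / 2) + 98 * K * s⁻¹ ^ 4) := by
        apply mul_le_mul_of_nonneg_left _ (by positivity)
        refine fin.trans ?_
        have q1 : 8 * K * Real.exp (-(s / 2)) * (2 * s - 1) ≤
          8 * K * Real.exp (-(s / 2)) * (2 * s) := by gcongr; linarith
        have q2 : 2 * K * ep3 s * ((2 * s + 1) ^ (-2 : ℝ) / 2) ≤ 2 * K * ep3 s * (s⁻¹ ^ 2 / 2) := by
          gcongr
        linarith
    _ = K * (8 * (2 * (s ^ 3 * Real.exp (-(s / 2)))) + 16 * s⁻¹ + ep3 s + 98 * s⁻¹ ^ 2) := by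
        field_simp
        ring
    _ ≤ 200 * K * eta s := by
        have z1 : 0 ≤ s ^ 3 * Real.exp (-(s / 2)) := by positivity
        have z2 : 0 ≤ s⁻¹ := by positivity
        have z3 : 0 ≤ s⁻¹ ^ 2 := by positivity
        rw [mul_comm 200 K, mul_assoc]
        apply mul_le_mul_of_nonneg_left _ hK.le
        unfold eta
        linarith

lemma tendsto_s : Tendsto (fun Δ : ℝ => Real.sqrt (Real.log (1 / Δ))) (𝓝[>] 0) atTop := by
  refine Real.tendsto_sqrt_atTop.comp (Real.tendsto_log_atTop.comp ?_)
  refine (tendsto_inv_nhdsGT_zero (𝕜 := ℝ)).congr fun x => ?_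
  rw [one_div]

theorem fisher_information_alpha_beta (β : ℝ) (hβ : β ∈ Set.Ioo (-1 : ℝ) 1) :
    Filter.Tendsto
      (fun Δ : ℝ => Real.log (1 / Δ) *
        ∫ x : ℝ, fAlpha (2 - Δ) β x * fBeta (2 - Δ) β x / stableDensity (2 - Δ) β x)
      (nhdsWithin 0 (Set.Ioi 0)) (nhds 0) := by
  obtain ⟨K, hK, hb⟩ := main_bound β (abs_lt.2 hβ)
  have h1 : Tendsto (fun s : ℝ => s ^ 2 * ∫ x, GG (Real.exp (-s ^ 2)) β x) atTop (𝓝 0) := by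
    refine squeeze_zero_norm' hb ?_
    simpa using tendsto_eta.const_mul K
  refine (h1.comp tendsto_s).congr' ?_
  have hlt : ∀ᶠ Δ : ℝ in 𝓝[>] 0, Δ < 1 := nhdsWithin_le_nhds (gt_mem_nhds one_pos)
  filter_upwards [hlt, self_mem_nhdsWithin] with Δ h1 h0
  have h0 : 0 < Δ := h0
  have hl : 0 ≤ Real.log (1 / Δ) := Real.log_nonneg (by rw [le_div_iff₀ h0]; linarith)
  simp only [Function.comp]
  rw [Real.sq_sqrt hl, one_div, Real.log_inv, neg_neg, Real.exp_log h0]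
  rfl
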